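/- arXiv:2102.10360 — 5 statements merged into one kernel-verified Lean document; each statement's English description precedes it below -/
import Mathlib

section
/- Let n ≥ 5 be an integer and set Q = (n−4)(n−2)n(n+2)/16. Let u be a smooth positive function on the closed unit ball of ℝⁿ satisfying Δ²u(x) ≥ Q·u(x)^{(n+4)/(n−4)} for all x in the open unit ball B₁, and on the unit sphere ∂B₁ satisfying u = 1, ∂_ν u = −(n−4)/2, and Δu ≤ −(n+2)(n−4)/4. Then u(x) = (2/(1+|x|²))^{(n−4)/2} for all x in the closed unit ball. -/
open Metric Real

/-- The Euclidean Laplacian of a function on `ℝⁿ`, as the sum of pure second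
derivatives in the coordinate directions. -/
noncomputable def laplacian {n : ℕ} (u : EuclideanSpace ℝ (Fin n) → ℝ)
    (x : EuclideanSpace ℝ (Fin n)) : ℝ :=
  ∑ i : Fin n, iteratedFDeriv ℝ 2 u x ![EuclideanSpace.single i 1, EuclideanSpace.single i 1]

section Laplacian

variable {n : ℕ} {f g : EuclideanSpace ℝ (Fin n) → ℝ}

/-- The partial derivatives of a smooth function are smooth. -/
theorem contDiff_fderiv_apply_const (hf : ContDiff ℝ (⊤ : ℕ∞) f) (v : EuclideanSpace ℝ (Fin n)) :
    ContDiff ℝ (⊤ : ℕ∞) fun x => fderiv ℝ f x v :=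
  (hf.fderiv_right (m := (⊤ : ℕ∞)) (by simp)).clm_apply contDiff_const

theorem laplacian_eq_sum_fderiv (hf : ContDiff ℝ (⊤ : ℕ∞) f) (x : EuclideanSpace ℝ (Fin n)) :
    laplacian f x = ∑ i : Fin n, fderiv ℝ
      (fun y => fderiv ℝ f y (EuclideanSpace.single i 1)) x (EuclideanSpace.single i 1) := by
  have hd : DifferentiableAt ℝ (fderiv ℝ f) x :=
    (hf.fderiv_right (m := (⊤ : ℕ∞)) (by simp)).differentiable (by simp) x
  refine Finset.sum_congr rfl fun i _ => ?_
  rw [iteratedFDeriv_two_apply, fderiv_clm_apply hd (differentiableAt_const _)]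
  simp

theorem contDiff_laplacian (hf : ContDiff ℝ (⊤ : ℕ∞) f) :
    ContDiff ℝ (⊤ : ℕ∞) (laplacian f) := by
  rw [funext (laplacian_eq_sum_fderiv hf)]
  exact ContDiff.sum fun i _ => contDiff_fderiv_apply_const (contDiff_fderiv_apply_const hf _) _

theorem laplacian_const_mul (hf : ContDiff ℝ (⊤ : ℕ∞) f) (c : ℝ) :
    laplacian (fun x => c * f x) = fun x => c * laplacian f x := by
  funext x
  simp only [laplacian, Finset.mul_sum]
  refine Finset.sum_congr rfl fun i _ => ?_
  have := iteratedFDeriv_const_smul_apply (𝕜 := ℝ) (i := 2) (a := c) (x := x)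
    (hf.contDiffAt.of_le (WithTop.coe_le_coe.2 le_top))
  change iteratedFDeriv ℝ 2 (c • f) x _ = _
  rw [this]
  simp

theorem laplacian_add (hf : ContDiff ℝ (⊤ : ℕ∞) f) (hg : ContDiff ℝ (⊤ : ℕ∞) g) :
    laplacian (fun x => f x + g x) = fun x => laplacian f x + laplacian g x := by
  funext x
  simp only [laplacian, ← Finset.sum_add_distrib]
  refine Finset.sum_congr rfl fun i _ => ?_
  have := iteratedFDeriv_add_apply (𝕜 := ℝ) (i := 2) (x := x)
    (hf.contDiffAt.of_le (WithTop.coe_le_coe.2 le_top))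
    (hg.contDiffAt.of_le (WithTop.coe_le_coe.2 le_top))
  change iteratedFDeriv ℝ 2 (f + g) x _ = _
  rw [this]
  simp

theorem laplacian_sub (hf : ContDiff ℝ (⊤ : ℕ∞) f) (hg : ContDiff ℝ (⊤ : ℕ∞) g) :
    laplacian (fun x => f x - g x) = fun x => laplacian f x - laplacian g x := by
  have h : (fun x => f x - g x) = fun x => f x + (-1) * g x := by
    funext x; ring
  rw [h, laplacian_add hf (contDiff_const.mul hg), laplacian_const_mul hg]
  funext x; ring

end Laplacian

section RadialPower

variable {n : ℕ}

/-- The radial function `(1 + |x|²) ^ a`. -/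
noncomputable def radialPow (n : ℕ) (a : ℝ) (x : EuclideanSpace ℝ (Fin n)) : ℝ :=
  (1 + ‖x‖ ^ 2) ^ a

theorem radialPow_pos (a : ℝ) (x : EuclideanSpace ℝ (Fin n)) : 0 < radialPow n a x :=
  Real.rpow_pos_of_pos (by positivity) a

theorem contDiff_radialPow (a : ℝ) : ContDiff ℝ (⊤ : ℕ∞) (radialPow n a) :=
  (contDiff_const.add (contDiff_norm_sq ℝ)).rpow_const_of_ne fun x => by positivity

theorem radialPow_mul_radialPow (a b : ℝ) (x : EuclideanSpace ℝ (Fin n)) :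
    radialPow n a x * radialPow n b x = radialPow n (a + b) x :=
  (Real.rpow_add (by positivity) a b).symm

theorem mul_radialPow_sub_one (a : ℝ) (x : EuclideanSpace ℝ (Fin n)) :
    (1 + ‖x‖ ^ 2) * radialPow n (a - 1) x = radialPow n a x := by
  have h := radialPow_mul_radialPow 1 (a - 1) x
  rw [add_sub_cancel] at h
  rw [← h]
  simp only [radialPow, Real.rpow_one]

theorem fderiv_radialPow (a : ℝ) (x v : EuclideanSpace ℝ (Fin n)) :
    fderiv ℝ (radialPow n a) x v = 2 * a * radialPow n (a - 1) x * inner ℝ x v := by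
  have h : HasFDerivAt (fun y : EuclideanSpace ℝ (Fin n) => 1 + ‖y‖ ^ 2)
      (2 • innerSL ℝ x) x := (hasStrictFDerivAt_norm_sq x).hasFDerivAt.const_add 1
  have h' := h.rpow_const (p := a) (Or.inl (by positivity))
  have h2 : fderiv ℝ (radialPow n a) x = _ := h'.fderiv
  rw [h2]
  simp only [radialPow, smul_apply, innerSL_apply_apply, smul_eq_mul,
    nsmul_eq_mul, Nat.cast_ofNat]
  ring

theorem laplacian_radialPow (a : ℝ) (x : EuclideanSpace ℝ (Fin n)) :
    laplacian (radialPow n a) x = 2 * a * (n + 2 * a - 2) * radialPow n (a - 1) x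
      - 4 * a * (a - 1) * radialPow n (a - 2) x := by
  rw [laplacian_eq_sum_fderiv (contDiff_radialPow a)]
  have hterm : ∀ i : Fin n, fderiv ℝ
      (fun y => fderiv ℝ (radialPow n a) y (EuclideanSpace.single i 1)) x
        (EuclideanSpace.single i 1)
      = 2 * a * radialPow n (a - 1) x + 4 * a * (a - 1) * radialPow n (a - 2) x * x i ^ 2 := by
    intro i
    have e : (fun y => fderiv ℝ (radialPow n a) y (EuclideanSpace.single i 1))
        = fun y => (2 * a * radialPow n (a - 1) y) *
          innerSL ℝ (EuclideanSpace.single i (1 : ℝ)) y := by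
      funext y
      rw [fderiv_radialPow, innerSL_apply_apply, real_inner_comm]
    have hd : DifferentiableAt ℝ (radialPow n (a - 1)) x :=
      (contDiff_radialPow _).differentiable (by simp) x
    rw [e, fderiv_fun_mul (hd.const_mul _) (innerSL ℝ _).differentiableAt,
      fderiv_const_mul hd, ContinuousLinearMap.fderiv]
    simp only [add_apply, smul_apply, smul_eq_mul,
      fderiv_radialPow, innerSL_apply_apply]
    rw [show a - 1 - 1 = a - 2 by ring]
    simp [EuclideanSpace.inner_single_left, EuclideanSpace.inner_single_right]
    ring
  rw [Finset.sum_congr rfl fun i _ => hterm i, Finset.sum_add_distrib, ← Finset.mul_sum,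
    ← Finset.mul_sum, ← EuclideanSpace.real_norm_sq_eq]
  have h := mul_radialPow_sub_one (a - 1) x
  rw [show a - 1 - 1 = a - 2 by ring] at h
  simp only [Finset.sum_const, Finset.card_univ, Fintype.card_fin, nsmul_eq_mul]
  linear_combination (4 * a * (a - 1)) * h

end RadialPower

section RadialCutoff

open MeasureTheory

variable {n : ℕ} {f g : EuclideanSpace ℝ (Fin n) → ℝ} {η : ℝ → ℝ}

theorem hasCompactSupport_comp_one_sub_norm_sq (hη : ∀ t < 0, η t = 0) :
    HasCompactSupport fun x : EuclideanSpace ℝ (Fin n) => η (1 - ‖x‖ ^ 2) := by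
  refine HasCompactSupport.intro (isCompact_closedBall 0 1) fun x hx => hη _ ?_
  rw [mem_closedBall_zero_iff, not_le] at hx
  nlinarith

theorem deriv_eq_zero_of_eq_const_of_lt {a c : ℝ} (hη : ∀ t < a, η t = c) :
    ∀ t < a, deriv η t = 0 := fun t ht => by
  have h : η =ᶠ[nhds t] fun _ => c := (eventually_lt_nhds ht).mono hη
  rw [h.deriv_eq, deriv_const]

theorem integrable_comp_one_sub_norm_sq_mul (hη : ∀ t < 0, η t = 0) (hηc : Continuous η)
    (hf : Continuous f) :
    Integrable fun x : EuclideanSpace ℝ (Fin n) => η (1 - ‖x‖ ^ 2) * f x :=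
  Continuous.integrable_of_hasCompactSupport (by fun_prop)
    (hasCompactSupport_comp_one_sub_norm_sq hη).mul_right

theorem fderiv_comp_one_sub_norm_sq (hη : Differentiable ℝ η) (x v : EuclideanSpace ℝ (Fin n)) :
    fderiv ℝ (fun y : EuclideanSpace ℝ (Fin n) => η (1 - ‖y‖ ^ 2)) x v
      = -(2 * deriv η (1 - ‖x‖ ^ 2) * inner ℝ x v) := by
  have h : HasFDerivAt (fun y : EuclideanSpace ℝ (Fin n) => 1 - ‖y‖ ^ 2)
      (-(2 • innerSL ℝ x)) x := (hasStrictFDerivAt_norm_sq x).hasFDerivAt.const_sub 1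
  have h' := (hη (1 - ‖x‖ ^ 2)).hasDerivAt.comp_hasFDerivAt x h
  have h2 : fderiv ℝ (fun y : EuclideanSpace ℝ (Fin n) => η (1 - ‖y‖ ^ 2)) x = _ := h'.fderiv
  rw [h2]
  simp only [smul_apply, neg_apply, innerSL_apply_apply, smul_eq_mul, nsmul_eq_mul,
    Nat.cast_ofNat]
  ring

theorem fderiv_apply_self_eq_sum (x : EuclideanSpace ℝ (Fin n)) :
    fderiv ℝ f x x = ∑ i, x i * fderiv ℝ f x (EuclideanSpace.single i 1) := by
  have h := (EuclideanSpace.basisFun (Fin n) ℝ).sum_repr x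
  calc fderiv ℝ f x x = fderiv ℝ f x (∑ i, _) := congrArg (fderiv ℝ f x) h.symm
    _ = _ := by simp [map_sum]

/-- The second Green identity on the unit ball, with the boundary replaced by a radial cutoff. -/
theorem integral_cutoff_mul_laplacian_sub (hη : ContDiff ℝ (⊤ : ℕ∞) η) (hη0 : ∀ t < 0, η t = 0)
    (hf : ContDiff ℝ (⊤ : ℕ∞) f) (hg : ContDiff ℝ (⊤ : ℕ∞) g) :
    ∫ x, η (1 - ‖x‖ ^ 2) * (f x * laplacian g x - g x * laplacian f x)
      = 2 * ∫ x, deriv η (1 - ‖x‖ ^ 2) * (f x * fderiv ℝ g x x - g x * fderiv ℝ f x x) := by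
  let e : Fin n → EuclideanSpace ℝ (Fin n) := fun i => EuclideanSpace.single i 1
  let F : Fin n → EuclideanSpace ℝ (Fin n) → ℝ := fun i x =>
    f x * fderiv ℝ g x (e i) - g x * fderiv ℝ f x (e i)
  let χ : EuclideanSpace ℝ (Fin n) → ℝ := fun x => η (1 - ‖x‖ ^ 2)
  have hχ : ContDiff ℝ (⊤ : ℕ∞) χ := hη.comp (contDiff_const.sub (contDiff_norm_sq ℝ))
  have hχs : HasCompactSupport χ := hasCompactSupport_comp_one_sub_norm_sq hη0
  have hF : ∀ i, ContDiff ℝ (⊤ : ℕ∞) (F i) := fun i =>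
    (hf.mul (contDiff_fderiv_apply_const hg _)).sub (hg.mul (contDiff_fderiv_apply_const hf _))
  have hχF' : ∀ i, Integrable fun x => χ x * fderiv ℝ (F i) x (e i) := fun i =>
    (hχ.continuous.mul (contDiff_fderiv_apply_const (hF i) _).continuous
      ).integrable_of_hasCompactSupport hχs.mul_right
  have hχ'F : ∀ i, Integrable fun x => fderiv ℝ χ x (e i) * F i x := fun i =>
    ((contDiff_fderiv_apply_const hχ _).continuous.mul (hF i).continuous
      ).integrable_of_hasCompactSupport (hχs.fderiv_apply ℝ _).mul_right
  have hχF : ∀ i, Integrable fun x => χ x * F i x := fun i =>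
    (hχ.continuous.mul (hF i).continuous).integrable_of_hasCompactSupport hχs.mul_right
  have hdiv : ∀ x, f x * laplacian g x - g x * laplacian f x
      = ∑ i, fderiv ℝ (F i) x (e i) := by
    intro x
    rw [laplacian_eq_sum_fderiv hf, laplacian_eq_sum_fderiv hg, Finset.mul_sum, Finset.mul_sum,
      ← Finset.sum_sub_distrib]
    refine Finset.sum_congr rfl fun i _ => ?_
    have df : DifferentiableAt ℝ f x := hf.differentiable (by simp) x
    have dg : DifferentiableAt ℝ g x := hg.differentiable (by simp) x
    have df' : DifferentiableAt ℝ (fun y => fderiv ℝ f y (e i)) x :=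
      (contDiff_fderiv_apply_const hf _).differentiable (by simp) x
    have dg' : DifferentiableAt ℝ (fun y => fderiv ℝ g y (e i)) x :=
      (contDiff_fderiv_apply_const hg _).differentiable (by simp) x
    rw [fderiv_fun_sub (df.fun_mul dg') (dg.fun_mul df'), fderiv_fun_mul df dg', fderiv_fun_mul dg df']
    simp only [sub_apply, add_apply, smul_apply, smul_eq_mul, e]
    ring
  have hbdry : ∀ x, deriv η (1 - ‖x‖ ^ 2) * (f x * fderiv ℝ g x x - g x * fderiv ℝ f x x)
      = -(1 / 2) * ∑ i, fderiv ℝ χ x (e i) * F i x := by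
    intro x
    rw [fderiv_apply_self_eq_sum (f := f), fderiv_apply_self_eq_sum (f := g), Finset.mul_sum,
      Finset.mul_sum, ← Finset.sum_sub_distrib, Finset.mul_sum, Finset.mul_sum]
    refine Finset.sum_congr rfl fun i _ => ?_
    rw [fderiv_comp_one_sub_norm_sq (hη.differentiable (by simp))]
    simp only [EuclideanSpace.inner_single_right, e, F]
    simp
    ring
  simp_rw [hdiv, hbdry, integral_const_mul, Finset.mul_sum]
  rw [integral_finsetSum _ fun i _ => hχF' i, integral_finsetSum _ fun i _ => hχ'F i,
    Finset.sum_congr rfl fun i _ => integral_mul_fderiv_eq_neg_fderiv_mul_of_integrable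
      (hχ'F i) (hχF' i) (hχF i) (fun x _ => hχ.differentiable (by simp) x)
      (fun x _ => (hF i).differentiable (by simp) x), Finset.sum_neg_distrib]
  ring

/-- The cutoff form of `∫ div x = n · vol`. -/
theorem integral_deriv_cutoff_mul_norm_sq (hη : ContDiff ℝ (⊤ : ℕ∞) η)
    (hη0 : ∀ t < 0, η t = 0) :
    2 * ∫ x : EuclideanSpace ℝ (Fin n), deriv η (1 - ‖x‖ ^ 2) * ‖x‖ ^ 2
      = n * ∫ x : EuclideanSpace ℝ (Fin n), η (1 - ‖x‖ ^ 2) := by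
  have h := integral_cutoff_mul_laplacian_sub (n := n) hη hη0 (f := fun _ => 1) contDiff_const
    (contDiff_radialPow 1)
  have hl : laplacian (fun _ : EuclideanSpace ℝ (Fin n) => (1 : ℝ)) = 0 := by
    funext x
    simp [laplacian_eq_sum_fderiv (f := fun _ : EuclideanSpace ℝ (Fin n) => (1 : ℝ))
      contDiff_const]
  have e1 : ∀ x : EuclideanSpace ℝ (Fin n), η (1 - ‖x‖ ^ 2) *
      (1 * laplacian (radialPow n 1) x - radialPow n 1 x * laplacian (fun _ => 1) x)
      = 2 * n * η (1 - ‖x‖ ^ 2) := by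
    intro x
    simp [hl, laplacian_radialPow, radialPow]
    ring
  have e2 : ∀ x : EuclideanSpace ℝ (Fin n), deriv η (1 - ‖x‖ ^ 2) *
      (1 * fderiv ℝ (radialPow n 1) x x - radialPow n 1 x * fderiv ℝ (fun _ => (1 : ℝ)) x x)
      = 2 * (deriv η (1 - ‖x‖ ^ 2) * ‖x‖ ^ 2) := by
    intro x
    simp [fderiv_radialPow, radialPow]
    ring
  simp_rw [e1, e2, integral_const_mul] at h
  linarith

/-- A continuous function that is nonpositive on the unit sphere is at most `δ |x|²` near it. -/
theorem exists_forall_le_mul_norm_sq_of_nonpos_on_sphere {B : EuclideanSpace ℝ (Fin n) → ℝ}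
    (hBc : Continuous B) (hB : ∀ x ∈ sphere (0 : EuclideanSpace ℝ (Fin n)) 1, B x ≤ 0) {δ : ℝ}
    (hδ : 0 < δ) :
    ∃ ε, 0 < ε ∧ ε ≤ 1 ∧ ∀ x, ‖x‖ ≤ 1 → 1 - ‖x‖ ^ 2 ≤ ε → B x ≤ δ * ‖x‖ ^ 2 := by
  let K : Set (EuclideanSpace ℝ (Fin n)) := closedBall 0 1 ∩ {x | δ * ‖x‖ ^ 2 ≤ B x}
  have hK : IsCompact K := (isCompact_closedBall 0 1).inter_right
    (isClosed_le (by fun_prop) hBc)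
  rcases K.eq_empty_or_nonempty with h | h
  · refine ⟨1, one_pos, le_rfl, fun x hx _ => ?_⟩
    by_contra! hlt
    exact (h.subset ⟨mem_closedBall_zero_iff.2 hx, hlt.le⟩ : x ∈ (∅ : Set _))
  · obtain ⟨y, ⟨hy1, hy2⟩, hmax⟩ := hK.exists_isMaxOn h continuous_norm.continuousOn
    rw [mem_closedBall_zero_iff] at hy1
    have hylt : ‖y‖ < 1 := by
      refine lt_of_le_of_ne hy1 fun hy => ?_
      have := hB y (mem_sphere_zero_iff_norm.2 hy)
      simp only [Set.mem_ofPred_eq, hy] at hy2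
      linarith
    have hy0 := norm_nonneg y
    refine ⟨(1 - ‖y‖ ^ 2) / 2, by nlinarith, by nlinarith, fun x hx hxε => ?_⟩
    by_contra! hlt
    have hle : ‖x‖ ≤ ‖y‖ := hmax ⟨mem_closedBall_zero_iff.2 hx, hlt.le⟩
    have := norm_nonneg x
    nlinarith

/-- If `D` is the divergence on the unit ball of a field whose radial part `B` is nonpositive on
the unit sphere, and `D` is nonnegative, then `D` vanishes. -/
theorem eq_zero_of_cutoff_divergence {B D : EuclideanSpace ℝ (Fin n) → ℝ} (hBc : Continuous B)
    (hDc : Continuous D)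
    (hdiv : ∀ η : ℝ → ℝ, ContDiff ℝ (⊤ : ℕ∞) η → (∀ t < 0, η t = 0) →
      ∫ x, η (1 - ‖x‖ ^ 2) * D x = 2 * ∫ x, deriv η (1 - ‖x‖ ^ 2) * B x)
    (hD : ∀ x ∈ ball (0 : EuclideanSpace ℝ (Fin n)) 1, 0 ≤ D x)
    (hB : ∀ x ∈ sphere (0 : EuclideanSpace ℝ (Fin n)) 1, B x ≤ 0) :
    ∀ x ∈ ball (0 : EuclideanSpace ℝ (Fin n)) 1, D x = 0 := by
  intro x₀ hx₀
  by_contra hne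
  have hball : ∀ x : EuclideanSpace ℝ (Fin n), 0 < 1 - ‖x‖ ^ 2 → x ∈ ball 0 1 := fun x hx => by
    rw [mem_ball_zero_iff]
    nlinarith [norm_nonneg x]
  have hST0 : ∀ t < 0, smoothTransition t = 0 := fun t ht => smoothTransition.zero_of_nonpos ht.le
  have hc : 0 < ∫ x, smoothTransition (1 - ‖x‖ ^ 2) * D x := by
    refine integral_pos_of_integrable_nonneg_nonzero (x := x₀)
      (by have := smoothTransition.continuous; fun_prop)
      (integrable_comp_one_sub_norm_sq_mul hST0 smoothTransition.continuous hDc) (fun x => ?_) ?_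
    · rcases le_or_gt (1 - ‖x‖ ^ 2) 0 with h | h
      · simp [smoothTransition.zero_of_nonpos h]
      · exact mul_nonneg (smoothTransition.nonneg _) (hD x (hball x h))
    · refine mul_ne_zero (smoothTransition.pos_of_pos ?_).ne' hne
      rw [mem_ball_zero_iff] at hx₀
      nlinarith [norm_nonneg x₀]
  set c := ∫ x, smoothTransition (1 - ‖x‖ ^ 2) * D x
  let ind : EuclideanSpace ℝ (Fin n) → ℝ := (closedBall 0 1).indicator fun _ => 1
  have hind : Integrable ind := (integrable_indicator_iff measurableSet_closedBall).2
    (integrableOn_const (isCompact_closedBall _ _).measure_lt_top.ne)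
  have hM : 0 ≤ ∫ x, ind x :=
    integral_nonneg fun x => Set.indicator_nonneg (fun _ _ => zero_le_one) x
  set M := ∫ x, ind x
  obtain ⟨ε, hε0, hε1, hε⟩ := exists_forall_le_mul_norm_sq_of_nonpos_on_sphere hBc hB
    (δ := c / (n * M + 1)) (by positivity)
  set δ := c / (n * M + 1) with hδ
  let η : ℝ → ℝ := fun t => smoothTransition (t / ε)
  have hη : ContDiff ℝ (⊤ : ℕ∞) η := smoothTransition.contDiff.comp (contDiff_id.div_const ε)
  have hηmono : Monotone η := fun s t h =>
    smoothTransition.monotone (div_le_div_of_nonneg_right h hε0.le)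
  have hη0 : ∀ t < 0, η t = 0 := fun t ht =>
    smoothTransition.zero_of_nonpos (div_neg_of_neg_of_pos ht hε0).le
  have hη'0 : ∀ t < 0, deriv η t = 0 := deriv_eq_zero_of_eq_const_of_lt hη0
  have hη'1 : ∀ t, ε < t → deriv η t = 0 := fun t ht => by
    have h : η =ᶠ[nhds t] fun _ => 1 := (eventually_gt_nhds ht).mono fun s hs =>
      smoothTransition.one_of_one_le ((one_le_div hε0).2 (le_of_lt hs))
    rw [h.deriv_eq, deriv_const]
  have hη'c : Continuous (deriv η) := hη.continuous_deriv (by simp)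
  have h1 : c ≤ ∫ x, η (1 - ‖x‖ ^ 2) * D x := by
    refine integral_mono
      (integrable_comp_one_sub_norm_sq_mul hST0 smoothTransition.continuous hDc)
      (integrable_comp_one_sub_norm_sq_mul hη0 hη.continuous hDc) fun x => ?_
    rcases le_or_gt (1 - ‖x‖ ^ 2) 0 with h | h
    · simp [η, smoothTransition.zero_of_nonpos h,
        smoothTransition.zero_of_nonpos (div_nonpos_of_nonpos_of_nonneg h hε0.le)]
    · exact mul_le_mul_of_nonneg_right (smoothTransition.monotone (le_div_self h.le hε0 hε1))
        (hD x (hball x h))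
  have h2 : ∫ x, deriv η (1 - ‖x‖ ^ 2) * B x
      ≤ δ * ∫ x : EuclideanSpace ℝ (Fin n), deriv η (1 - ‖x‖ ^ 2) * ‖x‖ ^ 2 := by
    rw [← integral_const_mul]
    refine integral_mono (integrable_comp_one_sub_norm_sq_mul hη'0 hη'c hBc)
      ((integrable_comp_one_sub_norm_sq_mul hη'0 hη'c (by fun_prop)).const_mul δ) fun x => ?_
    change deriv η (1 - ‖x‖ ^ 2) * B x ≤ δ * (deriv η (1 - ‖x‖ ^ 2) * ‖x‖ ^ 2)
    rcases lt_or_ge (1 - ‖x‖ ^ 2) 0 with h | h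
    · simp [hη'0 _ h]
    · rcases lt_or_ge ε (1 - ‖x‖ ^ 2) with h' | h'
      · simp [hη'1 _ h']
      · have := mul_le_mul_of_nonneg_left (hε x (by nlinarith [norm_nonneg x]) h')
          (hηmono.deriv_nonneg (x := 1 - ‖x‖ ^ 2))
        linarith
  have h3 : ∫ x : EuclideanSpace ℝ (Fin n), η (1 - ‖x‖ ^ 2) ≤ M := by
    have hi : Integrable fun x : EuclideanSpace ℝ (Fin n) => η (1 - ‖x‖ ^ 2) :=
      Continuous.integrable_of_hasCompactSupport (by have := hη.continuous; fun_prop)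
        (hasCompactSupport_comp_one_sub_norm_sq hη0)
    refine integral_mono hi hind fun x => ?_
    by_cases hx : x ∈ closedBall (0 : EuclideanSpace ℝ (Fin n)) 1
    · simpa [ind, Set.indicator_of_mem hx] using smoothTransition.le_one _
    · simp only [ind, Set.indicator_of_notMem hx]
      rw [mem_closedBall_zero_iff, not_le] at hx
      exact (hη0 _ (by nlinarith)).le
  have h4 := integral_deriv_cutoff_mul_norm_sq (n := n) hη hη0
  have h5 := hdiv η hη hη0
  have hδ0 : 0 < δ := by positivity
  have h6 : c ≤ δ * (n * M) := by
    have : δ * (n * ∫ x : EuclideanSpace ℝ (Fin n), η (1 - ‖x‖ ^ 2)) ≤ δ * (n * M) := by gcongr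
    rw [← h4] at this
    linarith
  have h7 : δ * (n * M + 1) = c := div_mul_cancel₀ _ (by positivity)
  linarith

end RadialCutoff

section Bubble

variable {n : ℕ} {m : ℝ}

theorem laplacian_radialPow_neg (hm : (n : ℝ) = 2 * m + 4) :
    laplacian (radialPow n (-m)) = fun x =>
      -(4 * m) * radialPow n (-m - 1) x + -(4 * m * (m + 1)) * radialPow n (-m - 2) x := by
  funext x
  rw [laplacian_radialPow, hm]
  ring

theorem laplacian_laplacian_radialPow_neg (hm : (n : ℝ) = 2 * m + 4)
    (x : EuclideanSpace ℝ (Fin n)) :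
    laplacian (laplacian (radialPow n (-m))) x
      = 16 * (m * (m + 1) * (m + 2) * (m + 3)) * radialPow n (-m - 4) x := by
  rw [laplacian_radialPow_neg hm,
    laplacian_add (contDiff_const.mul (contDiff_radialPow _))
      (contDiff_const.mul (contDiff_radialPow _)),
    laplacian_const_mul (contDiff_radialPow _), laplacian_const_mul (contDiff_radialPow _)]
  simp only [laplacian_radialPow, hm]
  rw [show -m - 1 - 2 = -m - 3 by ring, show -m - 2 - 1 = -m - 3 by ring,
    show -m - 2 - 2 = -m - 4 by ring]
  ring

theorem laplacian_laplacian_radialPow_neg_sub_one (hm : (n : ℝ) = 2 * m + 4)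
    (x : EuclideanSpace ℝ (Fin n)) :
    laplacian (laplacian (radialPow n (-m - 1))) x
      = 16 * ((m + 1) * (m + 2) * (m + 3)) *
        ((m + 4) * radialPow n (-m - 5) x - 2 * radialPow n (-m - 4) x) := by
  have h : laplacian (radialPow n (-m - 1)) = fun x =>
      -(4 * (m + 1) * (m + 2)) * radialPow n (-m - 3) x := by
    funext x
    rw [laplacian_radialPow, hm, show -m - 1 - 2 = -m - 3 by ring]
    ring
  rw [h, laplacian_const_mul (contDiff_radialPow _)]
  simp only [laplacian_radialPow, hm]
  rw [show -m - 3 - 1 = -m - 4 by ring, show -m - 3 - 2 = -m - 5 by ring]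
  ring

/-- The infinitesimal dilation of the bubble `(2 / (1 + |x|²)) ^ m`, up to a constant factor. -/
noncomputable def bubbleKernel (n : ℕ) (m : ℝ) (x : EuclideanSpace ℝ (Fin n)) : ℝ :=
  2 * radialPow n (-m - 1) x - radialPow n (-m) x

theorem contDiff_bubbleKernel : ContDiff ℝ (⊤ : ℕ∞) (bubbleKernel n m) :=
  (contDiff_const.mul (contDiff_radialPow _)).sub (contDiff_radialPow _)

theorem bubbleKernel_eq (x : EuclideanSpace ℝ (Fin n)) :
    bubbleKernel n m x = (1 - ‖x‖ ^ 2) * radialPow n (-m - 1) x := by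
  rw [bubbleKernel, ← mul_radialPow_sub_one (-m)]
  ring

theorem fderiv_bubbleKernel (x v : EuclideanSpace ℝ (Fin n)) :
    fderiv ℝ (bubbleKernel n m) x v
      = 2 * fderiv ℝ (radialPow n (-m - 1)) x v - fderiv ℝ (radialPow n (-m)) x v := by
  have h : ∀ a, DifferentiableAt ℝ (radialPow n a) x := fun a =>
    (contDiff_radialPow a).differentiable (by simp) x
  have e : bubbleKernel n m = fun x => 2 * radialPow n (-m - 1) x - radialPow n (-m) x := rfl
  rw [e, fderiv_fun_sub ((h _).const_mul _) (h _), fderiv_const_mul (h _)]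
  simp

theorem laplacian_laplacian_bubbleKernel (hm : (n : ℝ) = 2 * m + 4)
    (x : EuclideanSpace ℝ (Fin n)) :
    laplacian (laplacian (bubbleKernel n m)) x
      = 16 * ((m + 1) * (m + 2) * (m + 3) * (m + 4)) * radialPow n (-4) x
        * bubbleKernel n m x := by
  have e : bubbleKernel n m = fun x => 2 * radialPow n (-m - 1) x - radialPow n (-m) x := rfl
  have h1 := contDiff_laplacian (contDiff_radialPow (n := n) (-m - 1))
  rw [e, laplacian_sub (contDiff_const.mul (contDiff_radialPow _)) (contDiff_radialPow _),
    laplacian_const_mul (contDiff_radialPow _),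
    laplacian_sub (contDiff_const.mul h1) (contDiff_laplacian (contDiff_radialPow _)),
    laplacian_const_mul h1]
  simp only [laplacian_laplacian_radialPow_neg hm, laplacian_laplacian_radialPow_neg_sub_one hm]
  have h4 : radialPow n (-m - 4) x = radialPow n (-4) x * radialPow n (-m) x := by
    rw [radialPow_mul_radialPow]; ring_nf
  have h5 : radialPow n (-m - 5) x = radialPow n (-4) x * radialPow n (-m - 1) x := by
    rw [radialPow_mul_radialPow]; ring_nf
  rw [h4, h5]
  ring

theorem radialPow_of_mem_sphere (a : ℝ) {x : EuclideanSpace ℝ (Fin n)}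
    (hx : x ∈ sphere (0 : EuclideanSpace ℝ (Fin n)) 1) : radialPow n a x = 2 ^ a := by
  rw [radialPow, mem_sphere_zero_iff_norm.1 hx]
  norm_num

theorem fderiv_bubbleKernel_apply_self_neg {x : EuclideanSpace ℝ (Fin n)}
    (hx : x ∈ sphere (0 : EuclideanSpace ℝ (Fin n)) 1) :
    fderiv ℝ (bubbleKernel n m) x x < 0 := by
  have h1 : (2 : ℝ) ^ (-m - 1) = 2 ^ (-m) / 2 := by
    rw [Real.rpow_sub two_pos, Real.rpow_one]
  have h2 : (2 : ℝ) ^ (-m - 1 - 1) = 2 ^ (-m) / 4 := by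
    rw [Real.rpow_sub two_pos, Real.rpow_one, h1]; ring
  have h0 : (0 : ℝ) < 2 ^ (-m) := by positivity
  rw [fderiv_bubbleKernel, fderiv_radialPow, fderiv_radialPow, radialPow_of_mem_sphere _ hx,
    radialPow_of_mem_sphere _ hx, h1, h2, real_inner_self_eq_norm_sq,
    mem_sphere_zero_iff_norm.1 hx]
  linarith

theorem div_one_add_norm_sq_rpow (x : EuclideanSpace ℝ (Fin n)) :
    (2 / (1 + ‖x‖ ^ 2)) ^ m = 2 ^ m * radialPow n (-m) x := by
  rw [Real.div_rpow two_pos.le (by positivity), radialPow, Real.rpow_neg (by positivity),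
    div_eq_mul_inv]

theorem bubble_rpow (hm : 0 < m) (x : EuclideanSpace ℝ (Fin n)) :
    (2 ^ m * radialPow n (-m) x) ^ ((m + 4) / m)
      = 16 * radialPow n (-4) x * (2 ^ m * radialPow n (-m) x) := by
  rw [← div_one_add_norm_sq_rpow, ← Real.rpow_mul (by positivity), mul_div_cancel₀ _ hm.ne',
    Real.rpow_add (by positivity), div_one_add_norm_sq_rpow, div_one_add_norm_sq_rpow,
    show (2 : ℝ) ^ (4 : ℝ) = 16 by norm_num]
  ring

end Bubble

/-- The graph of `t ↦ t ^ p` lies strictly above its tangent at `a`. -/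
theorem rpow_tangent_lt {a b p : ℝ} (ha : 0 < a) (hb : 0 < b) (hp : 1 < p) (hab : b ≠ a) :
    a ^ p * (1 + p * (b / a - 1)) < b ^ p := by
  have hpos : 0 < b / a := div_pos hb ha
  have h := one_add_mul_self_lt_rpow_one_add (s := b / a - 1) (by linarith)
    (fun h => hab ((div_eq_one_iff_eq ha.ne').1 (sub_eq_zero.1 h))) hp
  rw [add_sub_cancel, Real.div_rpow hb.le ha.le, lt_div_iff₀ (by positivity)] at h
  linarith

/-- Hemisphere rigidity, analytic form, `n ≥ 5` (Theorem A of the paper). -/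
theorem stmt_0 (n : ℕ) (hn : 5 ≤ n) (Q : ℝ)
    (hQ : Q = ((n : ℝ) - 4) * ((n : ℝ) - 2) * n * ((n : ℝ) + 2) / 16)
    (u : EuclideanSpace ℝ (Fin n) → ℝ) (hu : ContDiff ℝ (⊤ : ℕ∞) u)
    (hpos : ∀ x ∈ closedBall (0 : EuclideanSpace ℝ (Fin n)) 1, 0 < u x)
    (hineq : ∀ x ∈ ball (0 : EuclideanSpace ℝ (Fin n)) 1,
      laplacian (laplacian u) x ≥ Q * u x ^ (((n : ℝ) + 4) / ((n : ℝ) - 4)))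
    (hbd : ∀ x ∈ sphere (0 : EuclideanSpace ℝ (Fin n)) 1, u x = 1)
    (hnu : ∀ x ∈ sphere (0 : EuclideanSpace ℝ (Fin n)) 1,
      fderiv ℝ u x x = -(((n : ℝ) - 4) / 2))
    (hlap : ∀ x ∈ sphere (0 : EuclideanSpace ℝ (Fin n)) 1,
      laplacian u x ≤ -(((n : ℝ) + 2) * ((n : ℝ) - 4) / 4)) :
    ∀ x ∈ closedBall (0 : EuclideanSpace ℝ (Fin n)) 1,
      u x = (2 / (1 + ‖x‖ ^ 2)) ^ (((n : ℝ) - 4) / 2) := by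
  have hn' : (5 : ℝ) ≤ n := by exact_mod_cast hn
  obtain ⟨m, hm⟩ : ∃ m : ℝ, (n : ℝ) = 2 * m + 4 := ⟨((n : ℝ) - 4) / 2, by ring⟩
  have hm0 : 0 < m := by linarith
  have hexp : ((n : ℝ) + 4) / ((n : ℝ) - 4) = (m + 4) / m := by
    rw [hm]; field_simp; ring
  have hhalf : ((n : ℝ) - 4) / 2 = m := by rw [hm]; ring
  have hQm : Q = m * (m + 1) * (m + 2) * (m + 3) := by rw [hQ, hm]; ring
  have hQ0 : 0 < Q := by rw [hQm]; positivity
  rw [hhalf] at hnu ⊢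
  rw [hexp] at hineq
  simp_rw [div_one_add_norm_sq_rpow]
  let U : EuclideanSpace ℝ (Fin n) → ℝ := fun x => 2 ^ m * radialPow n (-m) x
  let w : EuclideanSpace ℝ (Fin n) → ℝ := fun x => u x - U x
  let Φ : EuclideanSpace ℝ (Fin n) → ℝ := bubbleKernel n m
  have hU : ContDiff ℝ (⊤ : ℕ∞) U := contDiff_const.mul (contDiff_radialPow _)
  have hw : ContDiff ℝ (⊤ : ℕ∞) w := hu.sub hU
  have hΦ : ContDiff ℝ (⊤ : ℕ∞) Φ := contDiff_bubbleKernel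
  have hLw : ContDiff ℝ (⊤ : ℕ∞) (laplacian w) := contDiff_laplacian hw
  have hLΦ : ContDiff ℝ (⊤ : ℕ∞) (laplacian Φ) := contDiff_laplacian hΦ
  have hU0 : ∀ x, 0 < U x := fun x => mul_pos (by positivity) (radialPow_pos _ x)
  have hlapw : laplacian w = fun x => laplacian u x - 2 ^ m * laplacian (radialPow n (-m)) x := by
    rw [laplacian_sub hu hU, laplacian_const_mul (contDiff_radialPow _)]
  have hbilapw : ∀ x, laplacian (laplacian w) x
      = laplacian (laplacian u) x - Q * (16 * radialPow n (-4) x * U x) := by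
    intro x
    have h1 := contDiff_laplacian (contDiff_radialPow (n := n) (-m))
    rw [hlapw, laplacian_sub (contDiff_laplacian hu) (contDiff_const.mul h1),
      laplacian_const_mul h1, hQm]
    simp only [laplacian_laplacian_radialPow_neg hm, U]
    rw [show -m - 4 = -4 + -m by ring, ← radialPow_mul_radialPow]
    ring
  -- Convexity of the nonlinearity, with the linearisation at `U`.
  have hconv : ∀ x ∈ ball (0 : EuclideanSpace ℝ (Fin n)) 1, u x ≠ U x →
      16 * ((m + 1) * (m + 2) * (m + 3) * (m + 4)) * radialPow n (-4) x * w x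
        < laplacian (laplacian w) x := by
    intro x hx hne
    have h := rpow_tangent_lt (hU0 x) (hpos x (ball_subset_closedBall hx))
      ((one_lt_div hm0).2 (by linarith : m < m + 4)) hne
    rw [bubble_rpow hm0] at h
    have h2 := mul_lt_mul_of_pos_left h hQ0
    have h3 := hineq x hx
    have hUx := (hU0 x).ne'
    have e : Q * (16 * radialPow n (-4) x * U x * (1 + (m + 4) / m * (u x / U x - 1)))
        = Q * (16 * radialPow n (-4) x * U x)
          + 16 * ((m + 1) * (m + 2) * (m + 3) * (m + 4)) * radialPow n (-4) x * w x := by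
      rw [hQm]
      simp only [w]
      field_simp
    change Q * (16 * radialPow n (-4) x * U x * _) < _ at h2
    rw [e] at h2
    rw [hbilapw]
    linarith
  let D : EuclideanSpace ℝ (Fin n) → ℝ := fun x =>
    (Φ x * laplacian (laplacian w) x - laplacian w x * laplacian Φ x)
      + (laplacian Φ x * laplacian w x - w x * laplacian (laplacian Φ) x)
  let B : EuclideanSpace ℝ (Fin n) → ℝ := fun x =>
    (Φ x * fderiv ℝ (laplacian w) x x - laplacian w x * fderiv ℝ Φ x x)
      + (laplacian Φ x * fderiv ℝ w x x - w x * fderiv ℝ (laplacian Φ) x x)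
  have hDeq : ∀ x, D x = Φ x * (laplacian (laplacian w) x
      - 16 * ((m + 1) * (m + 2) * (m + 3) * (m + 4)) * radialPow n (-4) x * w x) := by
    intro x
    simp only [D, Φ, laplacian_laplacian_bubbleKernel hm]
    ring
  have hΦ0 : ∀ x ∈ ball (0 : EuclideanSpace ℝ (Fin n)) 1, 0 < Φ x := by
    intro x hx
    rw [mem_ball_zero_iff] at hx
    simp only [Φ, bubbleKernel_eq]
    exact mul_pos (by nlinarith [norm_nonneg x]) (radialPow_pos _ x)
  have hfd : ∀ f : EuclideanSpace ℝ (Fin n) → ℝ, ContDiff ℝ (⊤ : ℕ∞) f →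
      Continuous fun x => fderiv ℝ f x x := fun f hf =>
    (hf.continuous_fderiv (by simp)).clm_apply continuous_id
  have cΦ := hΦ.continuous
  have cw := hw.continuous
  have cLw := hLw.continuous
  have cLΦ := hLΦ.continuous
  have cLLw := (contDiff_laplacian hLw).continuous
  have cLLΦ := (contDiff_laplacian hLΦ).continuous
  have fΦ := hfd _ hΦ
  have fw := hfd _ hw
  have fLw := hfd _ hLw
  have fLΦ := hfd _ hLΦ
  have hBc : Continuous B :=
    ((cΦ.mul fLw).sub (cLw.mul fΦ)).add ((cLΦ.mul fw).sub (cw.mul fLΦ))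
  have hDc : Continuous D :=
    ((cΦ.mul cLLw).sub (cLw.mul cLΦ)).add ((cLΦ.mul cLw).sub (cw.mul cLLΦ))
  have hws : ∀ x ∈ sphere (0 : EuclideanSpace ℝ (Fin n)) 1, w x = 0 := by
    intro x hx
    simp only [w, U, hbd x hx, radialPow_of_mem_sphere _ hx]
    rw [← Real.rpow_add two_pos]
    simp
  have hD0 : ∀ x ∈ ball (0 : EuclideanSpace ℝ (Fin n)) 1, D x = 0 := by
    refine eq_zero_of_cutoff_divergence hBc hDc (fun η hη hη0 => ?_) (fun x hx => ?_)
      fun x hx => ?_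
    · have hη'0 := deriv_eq_zero_of_eq_const_of_lt hη0
      have hη' : Continuous (deriv η) := hη.continuous_deriv (by simp)
      simp only [D, B, mul_add]
      rw [MeasureTheory.integral_add
          (integrable_comp_one_sub_norm_sq_mul hη0 hη.continuous
            ((cΦ.fun_mul cLLw).fun_sub (cLw.fun_mul cLΦ)))
          (integrable_comp_one_sub_norm_sq_mul hη0 hη.continuous
            ((cLΦ.fun_mul cLw).fun_sub (cw.fun_mul cLLΦ))),
        MeasureTheory.integral_add
          (integrable_comp_one_sub_norm_sq_mul hη'0 hη' ((cΦ.fun_mul fLw).fun_sub (cLw.fun_mul fΦ)))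
          (integrable_comp_one_sub_norm_sq_mul hη'0 hη' ((cLΦ.fun_mul fw).fun_sub (cw.fun_mul fLΦ))),
        integral_cutoff_mul_laplacian_sub hη hη0 hΦ hLw,
        integral_cutoff_mul_laplacian_sub hη hη0 hLΦ hw, mul_add]
    · rw [hDeq]
      refine mul_nonneg (hΦ0 x hx).le (sub_nonneg.2 ?_)
      by_cases hne : u x = U x
      · have := hineq x hx
        rw [hne, bubble_rpow hm0] at this
        rw [hbilapw]
        simp only [w, hne, sub_self, mul_zero]
        exact sub_nonneg.2 this
      · exact (hconv x hx hne).le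
    · have h0 : (2 : ℝ) ^ m * 2 ^ (-m) = 1 := by rw [← Real.rpow_add two_pos]; simp
      have h1 : (2 : ℝ) ^ (-m - 1) = 2 ^ (-m) / 2 := by
        rw [Real.rpow_sub two_pos, Real.rpow_one]
      have h2 : (2 : ℝ) ^ (-m - 2) = 2 ^ (-m) / 4 := by
        rw [Real.rpow_sub two_pos]; norm_num
      have hΦs : Φ x = 0 := by
        simp only [Φ, bubbleKernel_eq, mem_sphere_zero_iff_norm.1 hx]
        norm_num
      have hdw : fderiv ℝ w x x = 0 := by
        have hd : DifferentiableAt ℝ (radialPow n (-m)) x :=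
          (contDiff_radialPow _).differentiable (by simp) x
        rw [fderiv_fun_sub (hu.differentiable (by simp) x) (hU.differentiable (by simp) x),
          fderiv_const_mul hd]
        simp only [sub_apply, smul_apply, smul_eq_mul, fderiv_radialPow, hnu x hx,
          real_inner_self_eq_norm_sq, mem_sphere_zero_iff_norm.1 hx,
          radialPow_of_mem_sphere _ hx, h1]
        linear_combination m * h0
      have hlw : laplacian w x ≤ 0 := by
        have h := hlap x hx
        rw [hm] at h
        rw [hlapw, laplacian_radialPow_neg hm]
        simp only [radialPow_of_mem_sphere _ hx, h1, h2]
        have e : (2 : ℝ) ^ m * (-(4 * m) * (2 ^ (-m) / 2) + -(4 * m * (m + 1)) * (2 ^ (-m) / 4))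
            = -(m * (m + 3)) := by
          linear_combination (-(m * (m + 3))) * h0
        rw [e]
        linarith
      simp only [B, hΦs, hws x hx, hdw]
      have := mul_nonneg_of_nonpos_of_nonpos hlw (fderiv_bubbleKernel_apply_self_neg (m := m) hx).le
      simp only [Φ]
      linarith
  intro x hx
  rcases (mem_closedBall_zero_iff.1 hx).lt_or_eq with h | h
  · have hxb : x ∈ ball (0 : EuclideanSpace ℝ (Fin n)) 1 := mem_ball_zero_iff.2 h
    by_contra hne
    have h0 := hD0 x hxb
    rw [hDeq] at h0
    exact (mul_pos (hΦ0 x hxb) (sub_pos.2 (hconv x hxb hne))).ne' h0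
  · exact sub_eq_zero.1 (hws x (mem_sphere_zero_iff_norm.2 h))
end

section
/- Let v : [0,∞) → ℝ be a smooth function satisfying v''''(t) − 4v''(t) ≥ 6e^{4v(t)} for all t ≥ 0, with v(0) = 0, v'(0) = 0, v'''(0) ≥ 0, and lim_{t→∞} v'(t) = −1. Then v(t) = −ln(cosh t) for all t ≥ 0. -/
open Real Filter

/-- Maximum principle for `u'' ≥ 4u` on the half-line. -/
lemma nonpos_of_four_mul_le_second_deriv {u a b : ℝ → ℝ} (hu : ∀ t, HasDerivAt u (a t) t)
    (ha : ∀ t, HasDerivAt a (b t) t) (hb : ∀ t ≥ 0, 4 * u t ≤ b t) (h0 : u 0 = 0)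
    (hlim : Tendsto u atTop (nhds (-1))) : ∀ t ≥ 0, u t ≤ 0 := by
  intro t ht
  by_contra! hpos
  have hda : deriv u = a := funext fun s => (hu s).deriv
  obtain ⟨T, hTu, hTt⟩ :=
    ((hlim.eventually (gt_mem_nhds (by norm_num : (-1 : ℝ) < 0))).and
      (eventually_gt_atTop t)).exists
  have huc : Continuous u := continuous_iff_continuousAt.2 fun s => (hu s).continuousAt
  obtain ⟨m, hm, hmax⟩ := (isCompact_Icc (a := (0 : ℝ)) (b := T)).exists_isMaxOn
    ⟨t, ht, hTt.le⟩ huc.continuousOn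
  have hum : 0 < u m := hpos.trans_le (hmax ⟨ht, hTt.le⟩)
  have hm0 : 0 < m := hm.1.lt_of_ne (by rintro rfl; linarith)
  have hmT : m < T := hm.2.lt_of_ne (by rintro rfl; linarith)
  have hlocmax : IsLocalMax u m := hmax.isLocalMax (Icc_mem_nhds hm0 hmT)
  have ham : a m = 0 := hlocmax.hasDerivAt_eq_zero (hu m)
  have hbm : 0 < b m := by linarith [hb m hm0.le]
  have hlocmin : IsLocalMin u m := isLocalMin_of_deriv_deriv_pos
    (by rw [hda, (ha m).deriv]; exact hbm) (by rw [hda, ham]) huc.continuousAt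
  have hconst : u =ᶠ[nhds m] fun _ => u m := by
    filter_upwards [hlocmax, hlocmin] with s h₁ h₂ using le_antisymm h₁ h₂
  have hzero : a =ᶠ[nhds m] fun _ => 0 := by
    have := hconst.deriv
    rwa [hda, deriv_const'] at this
  have := hzero.deriv_eq
  rw [(ha m).deriv, deriv_const] at this
  linarith

/-- A differentiable function with a limit at infinity has small derivative at some arbitrarily
large points. -/
lemma exists_abs_deriv_lt_of_tendsto {u a : ℝ → ℝ} {l : ℝ} (hu : ∀ t, HasDerivAt u (a t) t)
    (hlim : Tendsto u atTop (nhds l)) {ε : ℝ} (hε : 0 < ε) (N : ℝ) : ∃ t > N, |a t| < ε := by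
  have hdiff : Tendsto (fun t => u (t + 1) - u t) atTop (nhds 0) := by
    simpa using (hlim.comp (tendsto_atTop_add_const_right _ 1 tendsto_id)).sub hlim
  obtain ⟨s, hs, hsN⟩ := ((hdiff.abs.eventually
    (gt_mem_nhds (by simpa using hε))).and (eventually_gt_atTop N)).exists
  obtain ⟨t, ht, hteq⟩ := exists_hasDerivAt_eq_slope u a (lt_add_one s)
    (fun x _ => (hu x).continuousAt.continuousWithinAt) (fun x _ => hu x)
  refine ⟨t, hsN.trans ht.1, ?_⟩
  rw [hteq]
  simpa using hs

/-- A function with a limit at infinity cannot be eventually uniformly convex. -/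
lemma exists_second_deriv_lt_of_tendsto {u a b : ℝ → ℝ} {l : ℝ}
    (hu : ∀ t, HasDerivAt u (a t) t) (ha : ∀ t, HasDerivAt a (b t) t)
    (hlim : Tendsto u atTop (nhds l)) {c : ℝ} (hc : 0 < c) (N : ℝ) : ∃ t > N, b t < c := by
  by_contra! h
  have hmono : MonotoneOn (fun t => a t - c * t) (Set.Ici N) := by
    have hd : ∀ t, HasDerivAt (fun t => a t - c * t) (b t - c) t := fun t =>
      ((ha t).sub ((hasDerivAt_id t).const_mul c)).congr_deriv (by ring)
    refine monotoneOn_of_hasDerivWithinAt_nonneg (convex_Ici N)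
      (fun t _ => (hd t).continuousAt.continuousWithinAt)
      (fun t _ => (hd t).hasDerivWithinAt) fun t ht => ?_
    rw [interior_Ici] at ht
    linarith [h t ht]
  obtain ⟨t, ht, hat⟩ := exists_abs_deriv_lt_of_tendsto hu hlim one_pos
    (max N (N + (1 - a N) / c))
  have hNt : N < t := (le_max_left _ _).trans_lt ht
  have h₁ : N + (1 - a N) / c < t := (le_max_right _ _).trans_lt ht
  have h₂ : (1 - a N) < (t - N) * c := (div_lt_iff₀ hc).1 (by linarith)
  have h₃ : a N - c * N ≤ a t - c * t := hmono Set.self_mem_Ici hNt.le hNt.le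
  linarith [(abs_lt.1 hat).2]

/-- A function whose derivative has a negative limit at infinity tends to `-∞`. -/
lemma tendsto_atBot_of_tendsto_deriv {v u : ℝ → ℝ} (hv : ∀ t, HasDerivAt v (u t) t)
    (hlim : Tendsto u atTop (nhds (-1))) : Tendsto v atTop atBot := by
  obtain ⟨N, hN⟩ := eventually_atTop.1
    (hlim.eventually (gt_mem_nhds (by norm_num : (-1 : ℝ) < -1 / 2)))
  have hd : ∀ t, HasDerivAt (fun t => v t + 1 / 2 * t) (u t + 1 / 2) t := fun t =>
    ((hv t).add ((hasDerivAt_id t).const_mul (1 / 2))).congr_deriv (by ring)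
  have hanti : AntitoneOn (fun t => v t + 1 / 2 * t) (Set.Ici N) := by
    refine antitoneOn_of_hasDerivWithinAt_nonpos (convex_Ici N)
      (fun t _ => (hd t).continuousAt.continuousWithinAt)
      (fun t _ => (hd t).hasDerivWithinAt) fun t ht => ?_
    linarith [hN t (interior_subset ht)]
  have hlin : Tendsto (fun t : ℝ => (v N + 1 / 2 * N) + (-1 / 2) * t) atTop atBot :=
    tendsto_atBot_add_const_left _ _ (tendsto_id.const_mul_atTop_of_neg (by norm_num))
  refine tendsto_atBot_mono' _ ?_ hlin
  filter_upwards [eventually_ge_atTop N] with t ht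
  have : v t + 1 / 2 * t ≤ v N + 1 / 2 * N := hanti Set.self_mem_Ici ht ht
  linarith

/-- The energy `v'v''' - v''²/2 - 2v'² - (3/2)e^{4v}` is nonincreasing; comparing its values at `0`
and at infinity bounds `v''(0)`. -/
lemma sq_second_deriv_zero_le_one {v u a b c : ℝ → ℝ} (hv : ∀ t, HasDerivAt v (u t) t)
    (hu : ∀ t, HasDerivAt u (a t) t) (ha : ∀ t, HasDerivAt a (b t) t)
    (hb : ∀ t, HasDerivAt b (c t) t)
    (hineq : ∀ t ≥ 0, 6 * exp (4 * v t) ≤ c t - 4 * a t)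
    (h0 : v 0 = 0) (h1 : u 0 = 0) (h3 : 0 ≤ b 0)
    (hlim : Tendsto u atTop (nhds (-1))) : a 0 ^ 2 ≤ 1 := by
  have hmono : MonotoneOn (fun t => b t - 4 * u t) (Set.Ici 0) := by
    have hd : ∀ t, HasDerivAt (fun t => b t - 4 * u t) (c t - 4 * a t) t := fun t =>
      (hb t).sub ((hu t).const_mul 4)
    refine monotoneOn_of_hasDerivWithinAt_nonneg (convex_Ici 0)
      (fun t _ => (hd t).continuousAt.continuousWithinAt)
      (fun t _ => (hd t).hasDerivWithinAt) fun t ht => ?_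
    have := hineq t (interior_subset ht)
    linarith [exp_pos (4 * v t)]
  have hneg : ∀ t ≥ 0, u t ≤ 0 := by
    refine nonpos_of_four_mul_le_second_deriv hu ha (fun t ht => ?_) h1 hlim
    have : b 0 - 4 * u 0 ≤ b t - 4 * u t := hmono Set.self_mem_Ici ht ht
    linarith
  have hupper : ∀ t ≥ 0, b t - 4 * u t ≤ 4 := by
    intro t ht
    by_contra! hgt
    set δ := b t - 4 * u t - 4 with hδ
    have hδpos : 0 < δ := by linarith
    obtain ⟨N, hN⟩ := eventually_atTop.1
      (hlim.eventually (lt_mem_nhds (by linarith : -1 - δ / 8 < -1)))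
    obtain ⟨s, hs, hbs⟩ := exists_second_deriv_lt_of_tendsto hu ha hlim (half_pos hδpos) (max N t)
    have hts : t ≤ s := (le_max_right _ _).trans hs.le
    have h₁ := hN s ((le_max_left _ _).trans hs.le)
    have h₂ : b t - 4 * u t ≤ b s - 4 * u s := hmono ht (ht.trans hts) hts
    linarith
  have hanti : AntitoneOn
      (fun t => u t * b t - a t ^ 2 / 2 - 2 * u t ^ 2 - 3 / 2 * exp (4 * v t)) (Set.Ici 0) := by
    have hd : ∀ t, HasDerivAt
        (fun t => u t * b t - a t ^ 2 / 2 - 2 * u t ^ 2 - 3 / 2 * exp (4 * v t))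
        (u t * (c t - 4 * a t - 6 * exp (4 * v t))) t := fun t => by
      refine (((((hu t).mul (hb t)).sub (((ha t).pow 2).div_const 2)).sub
        (((hu t).pow 2).const_mul 2)).sub
        ((((hv t).const_mul 4).exp).const_mul (3 / 2))).congr_deriv ?_
      push_cast
      ring
    refine antitoneOn_of_hasDerivWithinAt_nonpos (convex_Ici 0)
      (fun t _ => (hd t).continuousAt.continuousWithinAt)
      (fun t _ => (hd t).hasDerivWithinAt) fun t ht => ?_
    have ht0 : 0 ≤ t := interior_subset (s := Set.Ici (0 : ℝ)) ht
    exact mul_nonpos_of_nonpos_of_nonneg (hneg t ht0) (by linarith [hineq t ht0])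
  refine le_of_forall_pos_le_add fun ε hε => ?_
  have hexp : Tendsto (fun t => exp (4 * v t)) atTop (nhds 0) :=
    tendsto_exp_atBot.comp
      ((tendsto_atBot_of_tendsto_deriv hv hlim).const_mul_atBot (by norm_num))
  have hmain : Tendsto (fun t => 4 * u t + 2 * u t ^ 2 - 3 / 2 * exp (4 * v t)) atTop
      (nhds (-2)) := by
    convert ((hlim.const_mul 4).add ((hlim.pow 2).const_mul 2)).sub (hexp.const_mul (3 / 2))
      using 2
    norm_num
  obtain ⟨N, hN⟩ := eventually_atTop.1
    (hmain.eventually (lt_mem_nhds (by linarith : -2 - ε / 4 < -2)))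
  obtain ⟨t, ht, hat⟩ := exists_abs_deriv_lt_of_tendsto hu hlim
    (sqrt_pos.2 (half_pos hε)) (max N 0)
  have ht0 : 0 ≤ t := (le_max_right _ _).trans ht.le
  have hsq : a t ^ 2 < ε / 2 := by
    rw [← sq_abs, ← Real.sq_sqrt (half_pos hε).le]
    exact pow_lt_pow_left₀ hat (abs_nonneg _) two_ne_zero
  have hH : u t * b t - a t ^ 2 / 2 - 2 * u t ^ 2 - 3 / 2 * exp (4 * v t) ≤
      u 0 * b 0 - a 0 ^ 2 / 2 - 2 * u 0 ^ 2 - 3 / 2 * exp (4 * v 0) :=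
    hanti Set.self_mem_Ici ht0 ht0
  rw [h0, h1, mul_zero, exp_zero] at hH
  have h₁ := hN t ((le_max_left _ _).trans ht.le)
  have h₂ := mul_le_mul_of_nonpos_left (hupper t ht0) (hneg t ht0)
  linarith

/-- Positivity of the third derivative is propagated by `φ'''' > 0` wherever
`φ, φ'' > 0`. -/
lemma third_deriv_pos {φ p q r s : ℝ → ℝ} (hφ : ∀ t, HasDerivAt φ (p t) t)
    (hp : ∀ t, HasDerivAt p (q t) t) (hq : ∀ t, HasDerivAt q (r t) t)
    (hr : ∀ t, HasDerivAt r (s t) t)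
    (hs : ∀ t ≥ 0, 0 < φ t → 0 < q t → 0 < s t)
    (hφ0 : 0 < φ 0) (hp0 : 0 < p 0) (hq0 : 0 < q 0) (hr0 : 0 < r 0) :
    ∀ t ≥ 0, 0 < r t := by
  intro t ht
  by_contra! hneg
  have hrc : Continuous r := continuous_iff_continuousAt.2 fun x => (hr x).continuousAt
  obtain ⟨T, ⟨hT, hrT⟩, hleast⟩ :=
    ((isCompact_Icc (a := (0 : ℝ)) (b := t)).inter_right
      (isClosed_le hrc continuous_const)).exists_isLeast ⟨t, ⟨ht, le_rfl⟩, hneg⟩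
  have hpos : ∀ x ∈ Set.Ico 0 T, 0 < r x := by
    intro x hx
    by_contra! hle
    exact absurd (hleast ⟨⟨hx.1, hx.2.le.trans hT.2⟩, hle⟩) (not_le.2 hx.2)
  have propagate : ∀ {f g : ℝ → ℝ}, (∀ x, HasDerivAt f (g x) x) → 0 < f 0 →
      (∀ x ∈ Set.Ico 0 T, 0 < g x) → ∀ x ∈ Set.Icc 0 T, 0 < f x := by
    intro f g hfg hf0 hg x hx
    have hmono : MonotoneOn f (Set.Icc 0 T) := by
      refine monotoneOn_of_hasDerivWithinAt_nonneg (convex_Icc 0 T)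
        (fun y _ => (hfg y).continuousAt.continuousWithinAt)
        (fun y _ => (hfg y).hasDerivWithinAt) fun y hy => ?_
      rw [interior_Icc] at hy
      exact (hg y ⟨hy.1.le, hy.2⟩).le
    exact hf0.trans_le (hmono ⟨le_rfl, hT.1⟩ hx hx.1)
  have hqpos := propagate hq hq0 hpos
  have hppos := propagate hp hp0 fun x hx => hqpos x ⟨hx.1, hx.2.le⟩
  have hφpos := propagate hφ hφ0 fun x hx => hppos x ⟨hx.1, hx.2.le⟩
  have hrpos := propagate hr hr0 fun x hx =>
    hs x hx.1 (hφpos x ⟨hx.1, hx.2.le⟩) (hqpos x ⟨hx.1, hx.2.le⟩)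
  exact absurd (hrpos T ⟨hT.1, le_rfl⟩) (not_lt.2 hrT)

/-- Comparison principle for `z'''' - 4z'' ≥ k z` with `0 ≤ k ≤ 24`. -/
lemma third_deriv_nonneg {z p q r s k : ℝ → ℝ} (hz : ∀ t, HasDerivAt z (p t) t)
    (hp : ∀ t, HasDerivAt p (q t) t) (hq : ∀ t, HasDerivAt q (r t) t)
    (hr : ∀ t, HasDerivAt r (s t) t)
    (hk0 : ∀ t, 0 ≤ k t) (hk : ∀ t, k t ≤ 24)
    (hs : ∀ t ≥ 0, k t * z t ≤ s t - 4 * q t)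
    (hz0 : 0 ≤ z 0) (hp0 : 0 ≤ p 0) (hq0 : 0 ≤ q 0) (hr0 : 0 ≤ r 0) :
    ∀ t ≥ 0, 0 ≤ r t := by
  have hE : ∀ (d t : ℝ), HasDerivAt (fun t => d * exp (3 * t)) (3 * d * exp (3 * t)) t := by
    intro d t
    refine ((((hasDerivAt_id t).const_mul 3).exp).const_mul d).congr_deriv ?_
    simp only [id]
    ring
  have key : ∀ ε > 0, ∀ t ≥ 0, 0 < r t + 3 * (3 * (3 * ε)) * exp (3 * t) := by
    intro ε hε
    refine third_deriv_pos (φ := fun t => z t + ε * exp (3 * t))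
      (fun t => (hz t).add (hE ε t)) (fun t => (hp t).add (hE _ t))
      (fun t => (hq t).add (hE _ t)) (fun t => (hr t).add (hE _ t)) ?_ ?_ ?_ ?_ ?_
    · intro t ht hφ hq'
      have hεe : 0 < ε * exp (3 * t) := mul_pos hε (exp_pos _)
      have h₁ := mul_nonneg (hk0 t) hφ.le
      have h₂ := mul_le_mul_of_nonneg_right (hk t) hεe.le
      have h₃ := hs t ht
      nlinarith
    all_goals simp only [mul_zero, exp_zero]; positivity
  intro t ht
  refine le_of_forall_pos_le_add fun δ hδ => ?_
  have he := exp_pos (3 * t)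
  have := key (δ / (27 * exp (3 * t))) (by positivity) t ht
  have heq : 3 * (3 * (3 * (δ / (27 * exp (3 * t))))) * exp (3 * t) = δ := by
    field_simp
    norm_num
  linarith

/-- Proposition 2.2 of the paper: rigidity for the fourth-order ODE inequality
`v'''' - 4v'' ≥ 6e^{4v}` on `[0,∞)`. -/
theorem stmt_3 (v : ℝ → ℝ) (hv : ContDiff ℝ (⊤ : ℕ∞) v)
    (hineq : ∀ t ≥ (0 : ℝ),
      deriv^[4] v t - 4 * deriv^[2] v t ≥ 6 * Real.exp (4 * v t))
    (h0 : v 0 = 0) (h1 : deriv v 0 = 0) (h3 : deriv^[3] v 0 ≥ 0)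
    (hlim : Tendsto (deriv v) atTop (nhds (-1))) :
    ∀ t ≥ (0 : ℝ), v t = -Real.log (Real.cosh t) := by
  have hd : ∀ n t, HasDerivAt (deriv^[n] v) (deriv^[n + 1] v t) t := by
    intro n t
    rw [Function.iterate_succ_apply']
    exact ((hv.iterate_deriv n).differentiable (by simp) t).hasDerivAt
  have ha0 : deriv^[2] v 0 ^ 2 ≤ 1 :=
    sq_second_deriv_zero_le_one (hd 0) (hd 1) (hd 2) (hd 3) hineq h0 h1 h3 hlim
  have hcosh : ∀ t, cosh t ≠ 0 := fun t => (cosh_pos t).ne'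
  have hz : ∀ t, HasDerivAt (fun t => v t + log (cosh t))
      (deriv v t + sinh t / cosh t) t := fun t =>
    (hd 0 t).add ((hasDerivAt_cosh t).log (hcosh t))
  have hp : ∀ t, HasDerivAt (fun t => deriv v t + sinh t / cosh t)
      (deriv^[2] v t + 1 / cosh t ^ 2) t := fun t => by
    refine ((hd 1 t).add ((hasDerivAt_sinh t).div (hasDerivAt_cosh t) (hcosh t))).congr_deriv ?_
    rw [← cosh_sq_sub_sinh_sq t]
    ring
  have hq : ∀ t, HasDerivAt (fun t => deriv^[2] v t + 1 / cosh t ^ 2)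
      (deriv^[3] v t + -2 * sinh t / cosh t ^ 3) t := fun t => by
    refine ((hd 2 t).add ((hasDerivAt_const t (1 : ℝ)).div ((hasDerivAt_cosh t).pow 2)
      (pow_ne_zero 2 (hcosh t)))).congr_deriv ?_
    have := hcosh t
    simp only [Pi.pow_apply, Nat.cast_ofNat]
    field_simp
    ring
  have hr : ∀ t, HasDerivAt (fun t => deriv^[3] v t + -2 * sinh t / cosh t ^ 3)
      (deriv^[4] v t + (4 / cosh t ^ 2 - 6 / cosh t ^ 4)) t := fun t => by
    refine ((hd 3 t).add (((hasDerivAt_sinh t).const_mul (-2)).div ((hasDerivAt_cosh t).pow 3)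
      (pow_ne_zero 3 (hcosh t)))).congr_deriv ?_
    have := hcosh t
    simp only [Pi.pow_apply, Nat.cast_ofNat]
    field_simp
    have hsq := sinh_sq t
    ring_nf
    rw [hsq]
    ring
  have hq0 : 0 ≤ deriv^[2] v 0 + 1 / cosh 0 ^ 2 := by
    rw [cosh_zero]
    linarith [(abs_le.1 ((sq_le_one_iff_abs_le_one _).1 ha0)).1]
  have hrnonneg := third_deriv_nonneg (k := fun t => 24 / cosh t ^ 4) hz hp hq hr
    (fun t => by positivity)
    (fun t => div_le_self (by norm_num) (one_le_pow₀ (one_le_cosh t)))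
    (fun t ht => by
      have hexp : exp (4 * v t) = exp (4 * (v t + log (cosh t))) / cosh t ^ 4 := by
        have hl : exp (4 * log (cosh t)) = cosh t ^ 4 := by
          rw [← exp_log (pow_pos (cosh_pos t) 4), log_pow]
          norm_num
        rw [mul_add, exp_add, hl, mul_div_assoc, div_self (pow_ne_zero 4 (hcosh t)), mul_one]
      have hconv := add_one_le_exp (4 * (v t + log (cosh t)))
      have hdiv : (4 * (v t + log (cosh t)) + 1) / cosh t ^ 4 ≤ exp (4 * v t) := by
        rw [hexp]
        gcongr
      have hin := hineq t ht
      have e₁ : 24 / cosh t ^ 4 * (v t + log (cosh t)) =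
        6 * ((4 * (v t + log (cosh t)) + 1) / cosh t ^ 4) - 6 / cosh t ^ 4 := by ring
      have e₂ : 4 * (1 / cosh t ^ 2) = 4 / cosh t ^ 2 := by ring
      linarith)
    (by simp [h0]) (by simp [h1])
    hq0
    (by simpa using h3)
  have mono : ∀ {f g : ℝ → ℝ}, (∀ t, HasDerivAt f (g t) t) → (∀ t ≥ 0, 0 ≤ g t) →
      MonotoneOn f (Set.Ici 0) := fun hfg hg =>
    monotoneOn_of_hasDerivWithinAt_nonneg (convex_Ici 0)
      (fun t _ => (hfg t).continuousAt.continuousWithinAt)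
      (fun t _ => (hfg t).hasDerivWithinAt) fun t ht => hg t (interior_subset ht)
  have hqnonneg : ∀ t ≥ 0, 0 ≤ deriv^[2] v t + 1 / cosh t ^ 2 := fun t ht =>
    hq0.trans (mono hq hrnonneg Set.self_mem_Ici ht ht)
  have hpmono := mono hp hqnonneg
  have hpzero : ∀ t ≥ 0, deriv v t + sinh t / cosh t = 0 := by
    intro t ht
    have hlim1 : Tendsto (fun s => deriv v s + 1) atTop (nhds 0) := by
      simpa using hlim.add_const 1
    refine le_antisymm (ge_of_tendsto hlim1 ?_) ?_
    · filter_upwards [eventually_ge_atTop t] with s hs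
      have h₁ : deriv v t + sinh t / cosh t ≤ deriv v s + sinh s / cosh s :=
        hpmono ht (ht.trans hs) hs
      have h₂ : sinh s / cosh s ≤ 1 := (div_le_one (cosh_pos s)).2 (sinh_lt_cosh s).le
      linarith
    · have h₁ : deriv v 0 + sinh 0 / cosh 0 ≤ deriv v t + sinh t / cosh t :=
        hpmono Set.self_mem_Ici ht ht
      simpa [h1] using h₁
  intro t ht
  have h₁ : v 0 + log (cosh 0) ≤ v t + log (cosh t) :=
    mono hz (fun t ht => (hpzero t ht).ge) Set.self_mem_Ici ht ht
  have h₂ : -(v 0 + log (cosh 0)) ≤ -(v t + log (cosh t)) :=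
    mono (fun t => (hz t).neg) (fun t ht => by rw [hpzero t ht, neg_zero])
      Set.self_mem_Ici ht ht
  rw [h0, cosh_zero, log_one] at h₁ h₂
  linarith
end

section
/- Let v : [0,∞) → ℝ be a smooth function satisfying v''''(t) − 4v''(t) ≥ 6e^{4v(t)} and v'(t) ≤ 0 for all t ≥ 0. Then the function F(t) = v'''(t)v'(t) − (1/2)v''(t)² − 2v'(t)² − (3/2)e^{4v(t)} is nonincreasing on [0,∞). -/
open Real Filter

/-- Each iterated derivative of a smooth function has the next one as its derivative. -/
theorem ContDiff.hasDerivAt_iterate_deriv {v : ℝ → ℝ} (hv : ContDiff ℝ (⊤ : ℕ∞) v)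
    (n : ℕ) (t : ℝ) : HasDerivAt (deriv^[n] v) (deriv^[n + 1] v t) t := by
  rw [Function.iterate_succ_apply', ← iteratedDeriv_eq_iterate]
  exact (hv.differentiable_iteratedDeriv n (by exact_mod_cast ENat.natCast_lt_top n) t).hasDerivAt

/-- The derivative of the first integral is a multiple of the derivative of `v`. -/
theorem hasDerivAt_firstIntegral {v : ℝ → ℝ} (hv : ContDiff ℝ (⊤ : ℕ∞) v) (t : ℝ) :
    HasDerivAt (fun t => deriv^[3] v t * deriv v t - (1 / 2) * (deriv^[2] v t) ^ 2
      - 2 * (deriv v t) ^ 2 - (3 / 2) * Real.exp (4 * v t))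
      (deriv v t * (deriv^[4] v t - 4 * deriv^[2] v t - 6 * Real.exp (4 * v t))) t := by
  have h0 : HasDerivAt v (deriv v t) t := hv.hasDerivAt_iterate_deriv 0 t
  have h1 : HasDerivAt (deriv v) (deriv^[2] v t) t := hv.hasDerivAt_iterate_deriv 1 t
  have h2 : HasDerivAt (deriv^[2] v) (deriv^[3] v t) t := hv.hasDerivAt_iterate_deriv 2 t
  have h3 : HasDerivAt (deriv^[3] v) (deriv^[4] v t) t := hv.hasDerivAt_iterate_deriv 3 t
  refine ((((h3.fun_mul h1).fun_sub ((h2.fun_pow 2).const_mul (1 / 2))).fun_sub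
    ((h1.fun_pow 2).const_mul 2)).fun_sub ((h0.const_mul 4).exp.const_mul (3 / 2))).congr_deriv ?_
  push_cast
  ring

/-- The monotone first-integral lemma in the proof of Proposition 2.2 of the paper:
if `v'''' - 4v'' ≥ 6e^{4v}` and `v' ≤ 0` on `[0,∞)`, then
`F = v'''v' - (1/2)(v'')² - 2(v')² - (3/2)e^{4v}` is nonincreasing on `[0,∞)`. -/
theorem stmt_5 (v : ℝ → ℝ) (hv : ContDiff ℝ (⊤ : ℕ∞) v)
    (hineq : ∀ t ≥ (0 : ℝ),
      deriv^[4] v t - 4 * deriv^[2] v t ≥ 6 * Real.exp (4 * v t))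
    (hmono : ∀ t ≥ (0 : ℝ), deriv v t ≤ 0) :
    AntitoneOn (fun t => deriv^[3] v t * deriv v t - (1 / 2) * (deriv^[2] v t) ^ 2
      - 2 * (deriv v t) ^ 2 - (3 / 2) * Real.exp (4 * v t)) (Set.Ici (0 : ℝ)) := by
  have hF := hasDerivAt_firstIntegral hv
  refine antitoneOn_of_hasDerivWithinAt_nonpos (convex_Ici 0)
    (fun t _ => (hF t).continuousAt.continuousWithinAt)
    (fun t _ => (hF t).hasDerivWithinAt) fun t ht => ?_
  have ht0 : 0 ≤ t := interior_subset ht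
  exact mul_nonpos_of_nonpos_of_nonneg (hmono t ht0) (sub_nonneg.2 (hineq t ht0))
end

section
/- Let v : [0,∞) → ℝ be a smooth function satisfying the equation v''''(t) − 4v''(t) = 6e^{4v(t)} for all t ≥ 0, with v(0) = 0, v'(0) = 0, v''(0) = −1, v'''(0) ≥ 0, and lim_{t→∞} v'(t) = −1. Then v'''(0) = 0 and v(t) = −ln(cosh t) for all t ≥ 0. -/
open Real Filter

/-- If `c f ≤ f'` then `f` grows at least like `e^{ct}`. -/
theorem mul_exp_le_of_mul_le_deriv {f f' : ℝ → ℝ} {c T : ℝ}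
    (hf : ∀ t ∈ Set.Icc 0 T, HasDerivAt f (f' t) t)
    (h : ∀ t ∈ Set.Ioo 0 T, c * f t ≤ f' t) :
    ∀ t ∈ Set.Icc 0 T, f 0 * exp (c * t) ≤ f t := by
  have hd : ∀ t ∈ Set.Icc 0 T, HasDerivAt (fun s => f s * exp (-c * s))
      (f' t * exp (-c * t) + f t * (exp (-c * t) * (-c * 1))) t := fun t ht =>
    (hf t ht).mul (((hasDerivAt_id t).const_mul (-c)).exp)
  have hmono : MonotoneOn (fun s => f s * exp (-c * s)) (Set.Icc 0 T) := by
    refine monotoneOn_of_deriv_nonneg (convex_Icc 0 T)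
      (fun t ht => (hd t ht).continuousAt.continuousWithinAt) ?_ ?_
    · intro t ht
      exact (hd t (interior_subset ht)).differentiableAt.differentiableWithinAt
    · intro t ht
      rw [(hd t (interior_subset ht)).deriv]
      rw [interior_Icc] at ht
      nlinarith [h t ht, exp_pos (-c * t)]
  intro t ht
  have hle := hmono ⟨le_refl 0, ht.1.trans ht.2⟩ ht ht.1
  simp only [mul_zero, exp_zero, mul_one] at hle
  calc f 0 * exp (c * t) ≤ f t * exp (-c * t) * exp (c * t) := by gcongr
    _ = f t := by rw [mul_assoc, ← exp_add]; simp

theorem nonneg_of_deriv_nonneg {f f' : ℝ → ℝ} {T : ℝ}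
    (hf : ∀ t ∈ Set.Icc 0 T, HasDerivAt f (f' t) t) (h0 : f 0 = 0)
    (h : ∀ t ∈ Set.Icc 0 T, 0 ≤ f' t) : ∀ t ∈ Set.Icc 0 T, 0 ≤ f t := by
  intro t ht
  have := mul_exp_le_of_mul_le_deriv (c := 0) hf
    (fun s hs => by simpa using h s ⟨hs.1.le, hs.2.le⟩) t ht
  simpa [h0] using this

theorem abs_exp_sub_exp_le {x y M : ℝ} (hx : x ≤ M) (hy : y ≤ M) :
    |exp x - exp y| ≤ exp M * |x - y| := by
  have key : ∀ a b : ℝ, a ≤ M → exp a - exp b ≤ exp M * |a - b| := by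
    intro a b ha
    have h1 : exp b = exp a * exp (b - a) := by rw [← exp_add]; ring_nf
    have h2 := add_one_le_exp (b - a)
    calc exp a - exp b ≤ exp a * (a - b) := by nlinarith [exp_pos a]
      _ ≤ exp a * |a - b| := by gcongr; exact le_abs_self _
      _ ≤ exp M * |a - b| := by gcongr
  rw [abs_le]
  constructor
  · have := key y x hy
    rw [abs_sub_comm] at this
    linarith
  · exact key x y hx

/-- `y` lists a function and its first three derivatives, and the function solves
`v'''' - 4v'' = 6e^{4v}` on `[0, ∞)`. -/
structure SolvesODE (y : Fin 4 → ℝ → ℝ) : Prop where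
  deriv_zero : ∀ t ≥ 0, HasDerivAt (y 0) (y 1 t) t
  deriv_one : ∀ t ≥ 0, HasDerivAt (y 1) (y 2 t) t
  deriv_two : ∀ t ≥ 0, HasDerivAt (y 2) (y 3 t) t
  deriv_three : ∀ t ≥ 0, HasDerivAt (y 3) (4 * y 2 t + 6 * exp (4 * y 0 t)) t

namespace SolvesODE

variable {y z : Fin 4 → ℝ → ℝ}

/-- Solutions with the same Cauchy data at `0` coincide. -/
theorem unique (hy : SolvesODE y) (hz : SolvesODE z) (h : ∀ i, y i 0 = z i 0)
    {t : ℝ} (ht : 0 ≤ t) : y 0 t = z 0 t := by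
  obtain ⟨M, hM⟩ : ∃ M, ∀ s ∈ Set.Icc 0 t, y 0 s ≤ M := by
    have hc : ContinuousOn (y 0) (Set.Icc 0 t) := fun s hs =>
      (hy.deriv_zero s hs.1).continuousAt.continuousWithinAt
    obtain ⟨M, hM⟩ := isCompact_Icc.bddAbove_image hc
    exact ⟨M, fun s hs => hM ⟨s, hs, rfl⟩⟩
  obtain ⟨N, hN⟩ : ∃ N, ∀ s ∈ Set.Icc 0 t, z 0 s ≤ N := by
    have hc : ContinuousOn (z 0) (Set.Icc 0 t) := fun s hs =>
      (hz.deriv_zero s hs.1).continuousAt.continuousWithinAt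
    obtain ⟨M, hM⟩ := isCompact_Icc.bddAbove_image hc
    exact ⟨M, fun s hs => hM ⟨s, hs, rfl⟩⟩
  set K := exp (4 * max M N) with hK
  have hKpos : 0 < K := exp_pos _
  -- the energy `∑ (yᵢ - zᵢ)²` satisfies a Grönwall inequality
  have hE := mul_exp_le_of_mul_le_deriv (c := 10 + 24 * K) (T := t)
    (f := fun s => -((y 0 s - z 0 s) ^ 2 + (y 1 s - z 1 s) ^ 2 + (y 2 s - z 2 s) ^ 2
      + (y 3 s - z 3 s) ^ 2))
    (fun s hs => ((((((hy.deriv_zero s hs.1).sub (hz.deriv_zero s hs.1)).pow 2).add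
      (((hy.deriv_one s hs.1).sub (hz.deriv_one s hs.1)).pow 2)).add
      (((hy.deriv_two s hs.1).sub (hz.deriv_two s hs.1)).pow 2)).add
      (((hy.deriv_three s hs.1).sub (hz.deriv_three s hs.1)).pow 2)).neg)
    (by
      intro s hs
      have hs' : s ∈ Set.Icc 0 t := ⟨hs.1.le, hs.2.le⟩
      have hexp := abs_exp_sub_exp_le (x := 4 * y 0 s) (y := 4 * z 0 s) (M := 4 * max M N)
        (by linarith [hM s hs', le_max_left M N]) (by linarith [hN s hs', le_max_right M N])
      rw [← mul_sub, abs_mul, abs_of_pos (by norm_num : (0 : ℝ) < 4), ← hK] at hexp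
      simp only [Pi.sub_apply]
      have hsplit : 4 * y 2 s + 6 * exp (4 * y 0 s) - (4 * z 2 s + 6 * exp (4 * z 0 s))
        = 4 * (y 2 s - z 2 s) + 6 * (exp (4 * y 0 s) - exp (4 * z 0 s)) := by ring
      rw [hsplit]
      generalize exp (4 * y 0 s) - exp (4 * z 0 s) = e at *
      generalize y 0 s - z 0 s = a at *
      generalize y 1 s - z 1 s = b at *
      generalize y 2 s - z 2 s = c at *
      generalize y 3 s - z 3 s = d at *
      have hde : d * e ≤ 2 * K * (a ^ 2 + d ^ 2) := by
        calc d * e ≤ |d| * |e| := by rw [← abs_mul]; exact le_abs_self _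
          _ ≤ |d| * (K * (4 * |a|)) := by gcongr
          _ ≤ 2 * K * (|a| ^ 2 + |d| ^ 2) := by nlinarith [sq_nonneg (|a| - |d|)]
          _ = _ := by rw [sq_abs, sq_abs]
      norm_num
      nlinarith [sq_nonneg (a - b), sq_nonneg (b - c), sq_nonneg (c - d), sq_nonneg a,
        sq_nonneg b, sq_nonneg c, sq_nonneg d, mul_nonneg hKpos.le (sq_nonneg b),
        mul_nonneg hKpos.le (sq_nonneg c), mul_nonneg hKpos.le (sq_nonneg a),
        mul_nonneg hKpos.le (sq_nonneg d)])
    t ⟨ht, le_refl t⟩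
  simp only [h, sub_self] at hE
  have hsq : (y 0 t - z 0 t) ^ 2 = 0 := by
    nlinarith [sq_nonneg (y 0 t - z 0 t), sq_nonneg (y 1 t - z 1 t),
      sq_nonneg (y 2 t - z 2 t), sq_nonneg (y 3 t - z 3 t)]
  exact sub_eq_zero.mp (pow_eq_zero_iff (two_ne_zero) |>.mp hsq)

/-- If the data agree up to order two and `y''' - z''' + 2 (y'' - z'')` is nonnegative on `[0, T)`,
then it grows at least like `e^{2t}` on `[0, T]`. -/
theorem mul_exp_le_of_nonneg (hy : SolvesODE y) (hz : SolvesODE z) (h0 : y 0 0 = z 0 0)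
    (h1 : y 1 0 = z 1 0) (h2 : y 2 0 = z 2 0) {T : ℝ}
    (hp : ∀ t ∈ Set.Ico 0 T, 0 ≤ y 3 t - z 3 t + 2 * (y 2 t - z 2 t)) :
    ∀ t ∈ Set.Icc 0 T,
      (y 3 0 - z 3 0) * exp (2 * t) ≤ y 3 t - z 3 t + 2 * (y 2 t - z 2 t) := by
  have hu2 : ∀ t ∈ Set.Icc 0 T, 0 ≤ y 2 t - z 2 t := by
    intro t ht
    have := mul_exp_le_of_mul_le_deriv (c := -2) (f := fun s => y 2 s - z 2 s)
      (fun s hs => (hy.deriv_two s hs.1).sub (hz.deriv_two s hs.1))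
      (fun s hs => by linarith [hp s ⟨hs.1.le, hs.2⟩]) t ht
    simpa [h2] using this
  have hu1 := nonneg_of_deriv_nonneg (f := fun s => y 1 s - z 1 s)
    (fun s hs => (hy.deriv_one s hs.1).sub (hz.deriv_one s hs.1)) (by simp [h1]) hu2
  have hu0 := nonneg_of_deriv_nonneg (f := fun s => y 0 s - z 0 s)
    (fun s hs => (hy.deriv_zero s hs.1).sub (hz.deriv_zero s hs.1)) (by simp [h0]) hu1
  intro t ht
  have := mul_exp_le_of_mul_le_deriv (c := 2)
    (f := fun s => y 3 s - z 3 s + 2 * (y 2 s - z 2 s))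
    (fun s hs => ((hy.deriv_three s hs.1).sub (hz.deriv_three s hs.1)).add
      (((hy.deriv_two s hs.1).sub (hz.deriv_two s hs.1)).const_mul 2))
    (fun s hs => by
      have hle : exp (4 * z 0 s) ≤ exp (4 * y 0 s) :=
        exp_le_exp.mpr (by linarith [hu0 s ⟨hs.1.le, hs.2.le⟩])
      linarith) t ht
  simpa [h2] using this

theorem third_add_second_sub_pos (hy : SolvesODE y) (hz : SolvesODE z) (h0 : y 0 0 = z 0 0)
    (h1 : y 1 0 = z 1 0) (h2 : y 2 0 = z 2 0) (h3 : z 3 0 < y 3 0) {t : ℝ} (ht : 0 ≤ t) :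
    0 < y 3 t - z 3 t + 2 * (y 2 t - z 2 t) := by
  by_contra! hneg
  set p : ℝ → ℝ := fun s => y 3 s - z 3 s + 2 * (y 2 s - z 2 s)
  have hc : ContinuousOn p (Set.Icc 0 t) := fun s hs =>
    (((hy.deriv_three s hs.1).sub (hz.deriv_three s hs.1)).add
      (((hy.deriv_two s hs.1).sub
        (hz.deriv_two s hs.1)).const_mul 2)).continuousAt.continuousWithinAt
  obtain ⟨T, ⟨hT, hpT⟩, hmin⟩ :=
    (isCompact_Icc.of_isClosed_subset (hc.preimage_isClosed_of_isClosed isClosed_Icc isClosed_Iic)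
      Set.inter_subset_left).exists_isLeast
      (⟨t, ⟨ht, le_refl t⟩, hneg⟩ : (Set.Icc 0 t ∩ p ⁻¹' Set.Iic 0).Nonempty)
  have hstep := mul_exp_le_of_nonneg hy hz h0 h1 h2 (T := T) (fun s hs => by
    by_contra! hlt
    exact absurd (hmin ⟨⟨hs.1, hs.2.le.trans hT.2⟩, hlt.le⟩) (not_le.mpr hs.2))
    T ⟨hT.1, le_refl T⟩
  have hpT' : y 3 T - z 3 T + 2 * (y 2 T - z 2 T) ≤ 0 := hpT
  have := mul_pos (sub_pos.mpr h3) (exp_pos (2 * T))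
  linarith

/-- The derivatives of two solutions cannot approach each other if the data agree up to order two
and differ at order three. -/
theorem not_tendsto_deriv_sub (hy : SolvesODE y) (hz : SolvesODE z) (h0 : y 0 0 = z 0 0)
    (h1 : y 1 0 = z 1 0) (h2 : y 2 0 = z 2 0) (h3 : z 3 0 < y 3 0) :
    ¬ Tendsto (fun t => y 1 t - z 1 t) atTop (nhds 0) := by
  intro hlim
  have hu2 : ∀ t > 0, 0 < y 2 t - z 2 t := by
    intro t ht
    set a := y 3 0 - z 3 0 with ha
    have hapos : 0 < a := sub_pos.mpr h3
    have hp := mul_exp_le_of_nonneg hy hz h0 h1 h2 (T := t)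
      (fun s hs => (third_add_second_sub_pos hy hz h0 h1 h2 h3 hs.1).le)
    have := mul_exp_le_of_mul_le_deriv (c := -2) (f := fun s => y 2 s - z 2 s - a / 2) (T := t)
      (fun s hs => ((hy.deriv_two s hs.1).sub (hz.deriv_two s hs.1)).sub_const _)
      (fun s hs => by
        have h1s : 1 ≤ exp (2 * s) := one_le_exp (by linarith [hs.1])
        have := hp s ⟨hs.1.le, hs.2.le⟩
        nlinarith) t ⟨ht.le, le_refl t⟩
    simp only [h2, sub_self, zero_sub] at this
    have hlt : exp (-2 * t) < 1 := by rw [← exp_zero]; exact exp_lt_exp.mpr (by linarith)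
    nlinarith
  have hd : ∀ t ≥ 0, HasDerivAt (fun s => y 1 s - z 1 s) (y 2 t - z 2 t) t := fun t ht =>
    (hy.deriv_one t ht).sub (hz.deriv_one t ht)
  have hmono : StrictMonoOn (fun s => y 1 s - z 1 s) (Set.Ici 0) := by
    refine strictMonoOn_of_deriv_pos (convex_Ici 0)
      (fun t ht => (hd t ht).continuousAt.continuousWithinAt) ?_
    intro t ht
    rw [interior_Ici] at ht
    rw [(hd t (le_of_lt ht)).deriv]
    exact hu2 t ht
  have hone : y 1 0 - z 1 0 < y 1 1 - z 1 1 :=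
    hmono (Set.mem_Ici.mpr le_rfl) (Set.mem_Ici.mpr zero_le_one) zero_lt_one
  have hle : y 1 1 - z 1 1 ≤ 0 := by
    refine ge_of_tendsto hlim ?_
    filter_upwards [eventually_ge_atTop 1] with t ht
    exact hmono.monotoneOn (Set.mem_Ici.mpr zero_le_one)
      (Set.mem_Ici.mpr (zero_le_one.trans ht)) ht
  linarith

/-- `-ln cosh` solves the equation. -/
theorem neg_log_cosh : SolvesODE ![fun t => -log (cosh t), fun t => -(sinh t / cosh t),
    fun t => -(1 / cosh t ^ 2), fun t => 2 * sinh t / cosh t ^ 3] where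
  deriv_zero t _ := ((hasDerivAt_cosh t).log (cosh_pos t).ne').neg
  deriv_one t _ := by
    have hc := (cosh_pos t).ne'
    have := ((hasDerivAt_sinh t).div (hasDerivAt_cosh t) hc).neg
    refine this.congr_deriv ?_
    have := cosh_sq t
    simp only [Matrix.cons_val]
    congr 2
    linarith
  deriv_two t _ := by
    have hc := (cosh_pos t).ne'
    have := ((hasDerivAt_const t (1 : ℝ)).div ((hasDerivAt_cosh t).pow 2) (pow_ne_zero 2 hc)).neg
    refine this.congr_deriv ?_
    simp only [Matrix.cons_val, Pi.pow_apply]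
    field_simp
    norm_num
    ring
  deriv_three t _ := by
    have hc := (cosh_pos t).ne'
    have := ((hasDerivAt_sinh t).const_mul 2).div ((hasDerivAt_cosh t).pow 3) (pow_ne_zero 3 hc)
    refine this.congr_deriv ?_
    have hexp : exp (4 * -log (cosh t)) = 1 / cosh t ^ 4 := by
      rw [mul_neg, exp_neg, mul_comm, exp_mul, exp_log (cosh_pos t), one_div]
      norm_cast
    simp only [Matrix.cons_val, Pi.pow_apply, hexp]
    field_simp
    norm_num
    rw [sinh_sq]
    ring

end SolvesODE

theorem tendsto_sinh_div_cosh_atTop :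
    Tendsto (fun t => sinh t / cosh t) atTop (nhds 1) := by
  have h : Tendsto (fun t : ℝ => exp (-2 * t)) atTop (nhds 0) :=
    tendsto_exp_atBot.comp (tendsto_id.const_mul_atTop_of_neg (by norm_num))
  have h' : Tendsto (fun t : ℝ => (1 - exp (-2 * t)) / (1 + exp (-2 * t))) atTop (nhds 1) := by
    simpa only [sub_zero, add_zero, div_one, Pi.div_def] using
      (h.const_sub 1).div (h.const_add 1) (by norm_num)
  refine h'.congr fun t => ?_
  have he : exp (-2 * t) = exp (-t) * exp (-t) := by rw [← exp_add]; ring_nf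
  have h1 : exp t * exp (-t) = 1 := by rw [← exp_add]; simp
  rw [sinh_eq, cosh_eq, he, div_div_div_cancel_right₀ two_ne_zero,
    div_eq_div_iff (by positivity) (by positivity)]
  linear_combination (-2 * exp (-t)) * h1

/-- Case 1 in the proof of Proposition 2.2 of the paper: a solution of
`v'''' - 4v'' = 6e^{4v}` with `v(0) = v'(0) = 0`, `v''(0) = -1`, `v'''(0) ≥ 0`
and `v'(t) → -1` must be `-ln cosh t`, and in particular `v'''(0) = 0`. -/
theorem stmt_7 (v : ℝ → ℝ) (hv : ContDiff ℝ (⊤ : ℕ∞) v)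
    (heq : ∀ t ≥ (0 : ℝ),
      deriv^[4] v t - 4 * deriv^[2] v t = 6 * Real.exp (4 * v t))
    (h0 : v 0 = 0) (h1 : deriv v 0 = 0) (h2 : deriv^[2] v 0 = -1)
    (h3 : deriv^[3] v 0 ≥ 0)
    (hlim : Tendsto (deriv v) atTop (nhds (-1))) :
    deriv^[3] v 0 = 0 ∧ ∀ t ≥ (0 : ℝ), v t = -Real.log (Real.cosh t) := by
  have hd : ∀ n t, HasDerivAt (deriv^[n] v) (deriv^[n + 1] v t) t := by
    intro n t
    rw [Function.iterate_succ_apply']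
    exact ((hv.iterate_deriv n).differentiable (by simp) t).hasDerivAt
  have hsol : SolvesODE ![v, deriv v, deriv^[2] v, deriv^[3] v] :=
    { deriv_zero := fun t _ => hd 0 t
      deriv_one := fun t _ => hd 1 t
      deriv_two := fun t _ => hd 2 t
      deriv_three := fun t ht => (hd 3 t).congr_deriv (by
        have := heq t ht
        simp only [Matrix.cons_val]
        linarith) }
  have h30 : deriv^[3] v 0 = 0 := by
    by_contra hne
    refine hsol.not_tendsto_deriv_sub SolvesODE.neg_log_cosh (by simp [h0]) (by simp [h1])
      (by simpa using h2) (by simpa using lt_of_le_of_ne h3 (Ne.symm hne)) ?_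
    simpa using hlim.add tendsto_sinh_div_cosh_atTop
  refine ⟨h30, fun t ht => ?_⟩
  refine hsol.unique SolvesODE.neg_log_cosh (fun i => ?_) ht
  fin_cases i
  · simp [h0]
  · simp [h1]
  · simpa using h2
  · simpa using h30
end

section
/- Let n ≥ 5 be an integer and Q = (n−4)(n−2)n(n+2)/16. Let u be a smooth positive radial solution of Δ²u = Q·u^{(n+4)/(n−4)} on the open unit ball B₁ ⊂ ℝⁿ, smooth up to the boundary, with u = 1 and ∂_ν u = −(n−4)/2 on ∂B₁. Then the boundary value of Δu satisfies Δu = −(n−4)(n+2)/4 on ∂B₁ or Δu = −(n−4)(n−2)/4 on ∂B₁. -/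
open Metric Real

open Topology in
/-- The gradient of a radial function away from the origin. -/
theorem hasFDerivAt_comp_norm {E : Type*} [NormedAddCommGroup E] [InnerProductSpace ℝ E]
    {φ : ℝ → ℝ} {c : ℝ} {v : E → ℝ} (hv : ∀ y, y ≠ 0 → v y = φ ‖y‖) {x : E} (hx : x ≠ 0)
    (hφ : HasDerivAt φ c ‖x‖) :
    HasFDerivAt v ((c / ‖x‖) • innerSL ℝ x) x := by
  have hnorm : HasFDerivAt (fun y : E => ‖y‖) (‖x‖⁻¹ • innerSL ℝ x) x := by
    have hsqrt := (hasStrictFDerivAt_norm_sq x).hasFDerivAt.sqrt (by simpa using hx)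
    simp only [Real.sqrt_sq (norm_nonneg _)] at hsqrt
    convert hsqrt using 1
    ext y
    simp
    ring
  have hev : v =ᶠ[𝓝 x] fun y => φ ‖y‖ := by
    filter_upwards [isOpen_ne.mem_nhds hx] with y hy using hv y hy
  refine HasFDerivAt.congr_of_eventuallyEq ?_ hev
  rw [div_eq_mul_inv, ← smul_smul]
  exact hφ.comp_hasFDerivAt x hnorm

open Topology in
/-- The Laplacian of a radial function away from the origin. -/
theorem laplacian_comp_norm {n : ℕ} {φ : ℝ → ℝ} (hφ : ContDiff ℝ 2 φ)
    {v : EuclideanSpace ℝ (Fin n) → ℝ} (hv : ∀ y, y ≠ 0 → v y = φ ‖y‖)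
    {x : EuclideanSpace ℝ (Fin n)} (hx : x ≠ 0) :
    laplacian v x = deriv (deriv φ) ‖x‖ + ((n : ℝ) - 1) / ‖x‖ * deriv φ ‖x‖ := by
  have hφ₁ : Differentiable ℝ φ := hφ.differentiable (by norm_num)
  have hφ₂ : Differentiable ℝ (deriv φ) := by
    have : ContDiff ℝ (1 + 1) φ := by simpa [one_add_one_eq_two] using hφ
    exact (contDiff_succ_iff_deriv.1 this).2.2.differentiable (by norm_num)
  have hr : ‖x‖ ≠ 0 := norm_ne_zero_iff.2 hx
  have hev : fderiv ℝ v =ᶠ[𝓝 x] fun y => (deriv φ ‖y‖ / ‖y‖) • innerSL ℝ y := by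
    filter_upwards [isOpen_ne.mem_nhds hx] with y hy
    exact (hasFDerivAt_comp_norm hv hy (hφ₁ _).hasDerivAt).fderiv
  have hquot := hasFDerivAt_comp_norm (v := fun y => deriv φ ‖y‖ / ‖y‖)
    (φ := fun s => deriv φ s / s) (fun y _ => rfl) hx
    ((hφ₂ ‖x‖).hasDerivAt.div (hasDerivAt_id ‖x‖) hr)
  have hsnd := (hquot.smul
    (innerSL ℝ (E := EuclideanSpace ℝ (Fin n))).hasFDerivAt).congr_of_eventuallyEq hev
  have hsum : ∑ i, x i * x i = ‖x‖ ^ 2 := by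
    rw [EuclideanSpace.norm_sq_eq]
    simp [sq]
  have hterm : ∀ i : Fin n, iteratedFDeriv ℝ 2 v x
      ![EuclideanSpace.single i 1, EuclideanSpace.single i 1] =
      deriv φ ‖x‖ / ‖x‖ +
        (deriv (deriv φ) ‖x‖ * ‖x‖ - deriv φ ‖x‖ * 1) / ‖x‖ ^ 2 / ‖x‖ * (x i * x i) := by
    intro i
    have hxi : inner ℝ x (EuclideanSpace.single i (1 : ℝ)) = x i := by
      simp [EuclideanSpace.inner_single_right]
    have hii : inner ℝ (EuclideanSpace.single i (1 : ℝ)) (EuclideanSpace.single i (1 : ℝ)) =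
        (1 : ℝ) := by simp
    rw [iteratedFDeriv_two_apply, hsnd.fderiv]
    change deriv φ ‖x‖ / ‖x‖ * inner ℝ (EuclideanSpace.single i (1 : ℝ))
        (EuclideanSpace.single i (1 : ℝ)) + _ * inner ℝ x (EuclideanSpace.single i (1 : ℝ)) *
          inner ℝ x (EuclideanSpace.single i (1 : ℝ)) = _
    rw [hxi, hii]
    ring
  simp only [laplacian, hterm, Finset.sum_add_distrib, ← Finset.mul_sum, hsum,
    Finset.sum_const, Finset.card_univ, Fintype.card_fin, nsmul_eq_mul]
  field_simp
  ring

/-- Taking the Laplacian costs two derivatives. -/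
theorem contDiff_laplacian_s12 {n : ℕ} {u : EuclideanSpace ℝ (Fin n) → ℝ} {k : ℕ∞}
    (hu : ContDiff ℝ (k + 2) u) : ContDiff ℝ k (laplacian u) := by
  have h := hu.iteratedFDeriv_right (m := k) (i := 2) le_rfl
  exact ContDiff.sum fun i _ =>
    (ContinuousMultilinearMap.apply ℝ (fun _ : Fin 2 => EuclideanSpace ℝ (Fin n)) ℝ
      ![EuclideanSpace.single i 1, EuclideanSpace.single i 1]).contDiff.comp h

/-- The Pohozaev identity on the unit ball for radial solutions of
`Δ²f = Q f^{(n+4)/(n-4)}`, where `g` is the radial profile of `Δf`. -/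
theorem pohozaev_radial {n : ℕ} (hn : 5 ≤ n) {Q : ℝ} {f g : ℝ → ℝ}
    (hf : ContDiff ℝ 2 f) (hg : ContDiff ℝ 2 g) (hpos : ∀ r ∈ Set.Icc (0 : ℝ) 1, 0 < f r)
    (hfg : ∀ r ∈ Set.Ioo (0 : ℝ) 1,
      g r = deriv (deriv f) r + ((n : ℝ) - 1) / r * deriv f r)
    (hgf : ∀ r ∈ Set.Ioo (0 : ℝ) 1,
      Q * f r ^ (((n : ℝ) + 4) / ((n : ℝ) - 4)) =
        deriv (deriv g) r + ((n : ℝ) - 1) / r * deriv g r) :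
    deriv f 1 * deriv g 1 - g 1 ^ 2 / 2
      - ((n : ℝ) - 4) / (2 * n) * Q * f 1 ^ (2 * (n : ℝ) / ((n : ℝ) - 4))
      + ((n : ℝ) - 4) / 2 * (deriv g 1 * f 1) + (n : ℝ) / 2 * (deriv f 1 * g 1) = 0 := by
  obtain ⟨m, rfl⟩ : ∃ m, n = m + 1 + 1 := ⟨n - 2, by omega⟩
  have hn4 : (5 : ℝ) ≤ ((m + 1 + 1 : ℕ) : ℝ) := by exact_mod_cast hn
  have hm : (((m + 1 + 1 : ℕ) : ℝ)) = m + 2 := by push_cast; ring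
  rw [hm] at hn4 hfg hgf ⊢
  have hderiv : ∀ {h : ℝ → ℝ}, ContDiff ℝ 2 h →
      Differentiable ℝ h ∧ Differentiable ℝ (deriv h) := by
    intro h hh
    have : ContDiff ℝ (1 + 1) h := by simpa [one_add_one_eq_two] using hh
    exact ⟨hh.differentiable (by norm_num),
      (contDiff_succ_iff_deriv.1 this).2.2.differentiable (by norm_num)⟩
  obtain ⟨hf₁, hf₂⟩ := hderiv hf
  obtain ⟨hg₁, hg₂⟩ := hderiv hg
  set q : ℝ := 2 * ((m : ℝ) + 2) / ((m : ℝ) + 2 - 4) with hq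
  set P : ℝ → ℝ := fun r =>
    r ^ (m + 2) * (deriv f r * deriv g r - g r ^ 2 / 2
      - ((m : ℝ) + 2 - 4) / (2 * ((m : ℝ) + 2)) * Q * f r ^ q)
    + r ^ (m + 1) * (((m : ℝ) + 2 - 4) / 2 * (deriv g r * f r)
      + ((m : ℝ) + 2) / 2 * (deriv f r * g r)) with hP
  have hcont : ContinuousOn P (Set.Icc 0 1) := by
    have hfq : ContinuousOn (fun r => f r ^ q) (Set.Icc 0 1) :=
      hf₁.continuous.continuousOn.rpow_const fun r hr => Or.inl (hpos r hr).ne'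
    have := hf₁.continuous
    have := hf₂.continuous
    have := hg₁.continuous
    have := hg₂.continuous
    fun_prop
  have hP' : ∀ r ∈ Set.Ioo (0 : ℝ) 1, HasDerivAt P 0 r := by
    intro r hr
    have hr0 : r ≠ 0 := hr.1.ne'
    have hfr : 0 < f r := hpos r ⟨hr.1.le, hr.2.le⟩
    have df := (hf₁ r).hasDerivAt
    have df' := (hf₂ r).hasDerivAt
    have dg := (hg₁ r).hasDerivAt
    have dg' := (hg₂ r).hasDerivAt
    have dq := df.rpow_const (p := q) (Or.inl hfr.ne')
    have hf'' := eq_sub_of_add_eq (hfg r hr).symm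
    have hg'' := eq_sub_of_add_eq (hgf r hr).symm
    have hq1 : q - 1 = ((m : ℝ) + 2 + 4) / ((m : ℝ) + 2 - 4) := by
      rw [hq]; field_simp [show (m : ℝ) + 2 - 4 ≠ 0 by linarith]; ring
    have hqf : f r ^ q = f r ^ (((m : ℝ) + 2 + 4) / ((m : ℝ) + 2 - 4)) * f r := by
      rw [← hq1, Real.rpow_sub_one hfr.ne']; field_simp
    have key := ((hasDerivAt_pow (m + 2) r).mul
        (((df'.mul dg').sub ((dg.pow 2).div_const 2)).sub
          (dq.const_mul (((m : ℝ) + 2 - 4) / (2 * ((m : ℝ) + 2)) * Q)))).add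
      ((hasDerivAt_pow (m + 1) r).mul
        (((dg'.mul df).const_mul (((m : ℝ) + 2 - 4) / 2)).add
          ((df'.mul dg).const_mul (((m : ℝ) + 2) / 2))))
    refine key.congr_deriv ?_
    rw [hq1]
    simp only [Pi.mul_apply, Pi.sub_apply, Pi.add_apply, Pi.pow_apply]
    rw [hqf, hf'', hg'', hq]
    generalize f r ^ (((m : ℝ) + 2 + 4) / ((m : ℝ) + 2 - 4)) = Y
    have h2 : (m : ℝ) + 2 ≠ 0 := by positivity
    have h4 : (m : ℝ) + 2 - 4 ≠ 0 := by linarith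
    simp only [show m + 2 - 1 = m + 1 from rfl, show m + 1 - 1 = m from rfl]
    push_cast
    field_simp
    ring
  obtain ⟨c, hc, hslope⟩ := exists_hasDerivAt_eq_slope P (fun _ => 0) zero_lt_one hcont hP'
  have hP0 : P 0 = 0 := by simp [hP]
  have hP1 : P 1 = 0 := by rw [hP0] at hslope; linarith
  rw [← hP1, hP]
  ring

/-- From the proof of Proposition 3.2 of the paper: by the Pohozaev identity,
a radial solution of `Δ²u = Q u^{(n+4)/(n-4)}` on `B₁` with `u = 1` and
`∂_ν u = -(n-4)/2` on `∂B₁` has `Δu = -(n-4)(n+2)/4` or `Δu = -(n-4)(n-2)/4`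
on the boundary. -/
theorem stmt_12 (n : ℕ) (hn : 5 ≤ n) (Q : ℝ)
    (hQ : Q = ((n : ℝ) - 4) * ((n : ℝ) - 2) * n * ((n : ℝ) + 2) / 16)
    (u : EuclideanSpace ℝ (Fin n) → ℝ) (hu : ContDiff ℝ (⊤ : ℕ∞) u)
    (hpos : ∀ x ∈ closedBall (0 : EuclideanSpace ℝ (Fin n)) 1, 0 < u x)
    (hrad : ∃ φ : ℝ → ℝ, ContDiff ℝ (⊤ : ℕ∞) φ ∧ ∀ x, u x = φ ‖x‖)
    (heq : ∀ x ∈ ball (0 : EuclideanSpace ℝ (Fin n)) 1,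
      laplacian (laplacian u) x = Q * u x ^ (((n : ℝ) + 4) / ((n : ℝ) - 4)))
    (hbd : ∀ x ∈ sphere (0 : EuclideanSpace ℝ (Fin n)) 1, u x = 1)
    (hnu : ∀ x ∈ sphere (0 : EuclideanSpace ℝ (Fin n)) 1,
      fderiv ℝ u x x = -(((n : ℝ) - 4) / 2)) :
    (∀ x ∈ sphere (0 : EuclideanSpace ℝ (Fin n)) 1,
        laplacian u x = -(((n : ℝ) - 4) * ((n : ℝ) + 2) / 4)) ∨
    (∀ x ∈ sphere (0 : EuclideanSpace ℝ (Fin n)) 1,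
        laplacian u x = -(((n : ℝ) - 4) * ((n : ℝ) - 2) / 4)) := by
  obtain ⟨φ, hφ, huφ⟩ := hrad
  have hφ₂ : ContDiff ℝ 2 φ := hφ.of_le (WithTop.coe_le_coe.2 le_top)
  have hlap : ContDiff ℝ 2 (laplacian u) :=
    contDiff_laplacian_s12 (k := 2) (hu.of_le (WithTop.coe_le_coe.2 le_top))
  set e : EuclideanSpace ℝ (Fin n) := EuclideanSpace.single ⟨0, by omega⟩ 1 with he
  have hnorm : ‖e‖ = 1 := by simp [he]
  have hray : ∀ r : ℝ, 0 ≤ r → ‖r • e‖ = r := fun r hr => by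
    simp [norm_smul, hnorm, abs_of_nonneg hr]
  have hray_ne : ∀ r : ℝ, 0 < r → r • e ≠ 0 := fun r hr =>
    norm_ne_zero_iff.1 (by rw [hray r hr.le]; exact hr.ne')
  set g : ℝ → ℝ := fun r => laplacian u (r • e) with hg
  have hg₂ : ContDiff ℝ 2 g := hlap.comp (contDiff_id.smul contDiff_const)
  have hradial : ∀ x, x ≠ 0 → laplacian u x =
      deriv (deriv φ) ‖x‖ + ((n : ℝ) - 1) / ‖x‖ * deriv φ ‖x‖ := fun x hx =>
    laplacian_comp_norm hφ₂ (fun y _ => huφ y) hx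
  have hug : ∀ x, x ≠ 0 → laplacian u x = g ‖x‖ := by
    intro x hx
    rw [hg, hradial x hx]
    beta_reduce
    rw [hradial _ (hray_ne _ (norm_pos_iff.2 hx)), hray _ (norm_nonneg x)]
  have hmem : ∀ r ∈ Set.Ioo (0 : ℝ) 1, r • e ∈ ball (0 : EuclideanSpace ℝ (Fin n)) 1 :=
    fun r hr => by rw [mem_ball_zero_iff, hray r hr.1.le]; exact hr.2
  have hpoh := pohozaev_radial hn (Q := Q) hφ₂ hg₂
    (fun r hr => by
      have := hpos (r • e) (by rw [mem_closedBall_zero_iff, hray r hr.1]; exact hr.2)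
      rwa [huφ, hray r hr.1] at this)
    (fun r hr => by
      have := hradial (r • e) (hray_ne r hr.1)
      rwa [hray r hr.1.le] at this)
    (fun r hr => by
      have := heq (r • e) (hmem r hr)
      rw [laplacian_comp_norm hg₂ hug (hray_ne r hr.1), huφ, hray r hr.1.le] at this
      exact this.symm)
  have he_mem : e ∈ sphere (0 : EuclideanSpace ℝ (Fin n)) 1 := by simp [hnorm]
  have he_ne : e ≠ 0 := norm_ne_zero_iff.1 (by simp [hnorm])
  have hφ1 : φ 1 = 1 := by rw [← hnorm, ← huφ, hbd e he_mem, hnorm]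
  have hφ'1 : deriv φ 1 = -(((n : ℝ) - 4) / 2) := by
    have hφd : DifferentiableAt ℝ φ ‖e‖ := hφ₂.differentiable (by norm_num) _
    rw [← hnu e he_mem,
      (hasFDerivAt_comp_norm (fun y _ => huφ y) he_ne hφd.hasDerivAt).fderiv]
    simp [hnorm]
  have hquad : (g 1 + ((n : ℝ) - 4) * ((n : ℝ) + 2) / 4) *
      (g 1 + ((n : ℝ) - 4) * ((n : ℝ) - 2) / 4) = 0 := by
    rw [hφ1, hφ'1, Real.one_rpow, hQ] at hpoh
    field_simp at hpoh
    linear_combination (-1 / 32 : ℝ) * hpoh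
  have hsphere : ∀ x ∈ sphere (0 : EuclideanSpace ℝ (Fin n)) 1, laplacian u x = g 1 := by
    intro x hx
    have hx1 : ‖x‖ = 1 := mem_sphere_zero_iff_norm.1 hx
    rw [hug x (norm_ne_zero_iff.1 (by simp [hx1])), hx1]
  refine (mul_eq_zero.1 hquad).imp (fun h x hx => ?_) (fun h x hx => ?_)
  all_goals rw [hsphere x hx]; exact eq_neg_of_add_eq_zero_left h
end
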